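/- arXiv:0809.1595 — 5 statements merged into one kernel-verified Lean document; each statement's English description precedes it below -/
import Mathlib

section
/- Suppose M and M* = Hom_R(M,R) are both (FP)_∞ R-modules. Then M is in G̃(R) if and only if M_m is in G̃(R_m) for every maximal ideal m of R. -/
open CategoryTheory Opposite TensorProduct

universe u

namespace AB

/-- `M` is `(FP)ₙ`: there is an exact sequence `Fₙ → ⋯ → F₀ → M → 0`
with each `Fᵢ` finitely generated free.  Equivalently (the form used here),
`(FP)₀` means finitely generated, and `M` is `(FP)_{n+1}` iff there is a
surjection from a finitely generated free module whose kernel is `(FP)ₙ`. -/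
def IsFP (R : Type u) [CommRing R] : ℕ → ModuleCat.{u} R → Prop
  | 0, M => Module.Finite R M
  | n + 1, M => ∃ (k : ℕ) (f : (Fin k → R) →ₗ[R] M), Function.Surjective f ∧
      IsFP R n (ModuleCat.of R (LinearMap.ker f))

/-- `M` is `(FP)_∞`. -/
def IsFPInf (R : Type u) [CommRing R] (M : ModuleCat.{u} R) : Prop := ∀ n, IsFP R n M

/-- `Ext^i_R(M, N)` as a type. -/
noncomputable abbrev ext (R : Type u) [CommRing R] (M N : ModuleCat.{u} R) (i : ℕ) :=
  ((Ext R (ModuleCat.{u} R) i).obj (op M)).obj N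

/-- `Ext^i_R(M, N) = 0`. -/
def extZero (R : Type u) [CommRing R] (M N : ModuleCat.{u} R) (i : ℕ) : Prop :=
  Subsingleton (ext R M N i)

/-- membership in the G-class `G(R)`. -/
def MemG (R : Type u) [CommRing R] (M : ModuleCat.{u} R) : Prop :=
  Module.Finite R M ∧ Module.IsReflexive R M ∧
    (∀ i > 0, extZero R M (ModuleCat.of R R) i) ∧
    (∀ i > 0, extZero R (ModuleCat.of R (Module.Dual R M)) (ModuleCat.of R R) i)

/-- membership in the restricted G-class `G̃(R)`. -/
def MemGtilde (R : Type u) [CommRing R] (M : ModuleCat.{u} R) : Prop :=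
  MemG R M ∧ IsFPInf R M ∧ IsFPInf R (ModuleCat.of R (Module.Dual R M))

/-- `Gdim_R M ≤ n`. -/
def GDimLe (R : Type u) [CommRing R] : ℕ → ModuleCat.{u} R → Prop
  | 0, M => MemG R M
  | n + 1, M => ∃ (G : ModuleCat.{u} R) (f : G →ₗ[R] M), MemG R G ∧ Function.Surjective f ∧
      GDimLe R n (ModuleCat.of R (LinearMap.ker f))

/-- `G̃dim_R M ≤ n`. -/
def GtildeDimLe (R : Type u) [CommRing R] : ℕ → ModuleCat.{u} R → Prop
  | 0, M => MemGtilde R M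
  | n + 1, M => ∃ (G : ModuleCat.{u} R) (f : G →ₗ[R] M), MemGtilde R G ∧ Function.Surjective f ∧
      GtildeDimLe R n (ModuleCat.of R (LinearMap.ker f))

/-- `pd_R M ≤ n`. -/
def ProjDimLe (R : Type u) [CommRing R] : ℕ → ModuleCat.{u} R → Prop
  | 0, M => Module.Projective R M
  | n + 1, M => ∃ (P : ModuleCat.{u} R) (f : P →ₗ[R] M), Module.Projective R P ∧
      Function.Surjective f ∧ ProjDimLe R n (ModuleCat.of R (LinearMap.ker f))

/-- The G-dimension of `M`, as an element of `ℕ∞` (`⊤` meaning `Gdim` is infinite/undefined). -/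
noncomputable def GDim (R : Type u) [CommRing R] (M : ModuleCat.{u} R) : ℕ∞ :=
  sInf {n : ℕ∞ | ∃ m : ℕ, n = m ∧ GDimLe R m M}

/-- The restricted G-dimension of `M`, as an element of `ℕ∞`. -/
noncomputable def GtildeDim (R : Type u) [CommRing R] (M : ModuleCat.{u} R) : ℕ∞ :=
  sInf {n : ℕ∞ | ∃ m : ℕ, n = m ∧ GtildeDimLe R m M}

/-- The projective dimension of `M`, as an element of `ℕ∞`. -/
noncomputable def ProjDim (R : Type u) [CommRing R] (M : ModuleCat.{u} R) : ℕ∞ :=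
  sInf {n : ℕ∞ | ∃ m : ℕ, n = m ∧ ProjDimLe R m M}

/-- The classical depth of `N` with respect to the ideal `I`: the supremum of the
lengths of regular sequences on `N` contained in `I`. -/
noncomputable def cdepth (S : Type u) [CommRing S] (I : Ideal S) (N : Type u)
    [AddCommGroup N] [Module S N] : ℕ∞ :=
  ⨆ rs : {l : List S // (∀ r ∈ l, r ∈ I) ∧ RingTheory.Sequence.IsRegular N l},
    (rs.1.length : ℕ∞)

/-- A bundled faithfully flat (commutative) algebra extension of `R`. -/
structure FFExt (R : Type u) [CommRing R] where
  S : Type u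
  [ring : CommRing S]
  [alg : Algebra R S]
  faithfullyFlat : Module.FaithfullyFlat R S

attribute [instance] FFExt.ring FFExt.alg

/-- The depth of a module `M` over a quasi-local ring `R`: the supremum, over all
faithfully flat extensions `S` of `R`, of the classical depth of `M ⊗_R S` with
respect to `mS`. -/
noncomputable def depth (R : Type u) [CommRing R] [IsLocalRing R] (M : Type u)
    [AddCommGroup M] [Module R M] : ℕ∞ :=
  ⨆ E : FFExt R,
    cdepth E.S (Ideal.map (algebraMap R E.S) (IsLocalRing.maximalIdeal R))
      (TensorProduct R E.S M)

end AB

namespace AB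

section Ext

variable {R : Type u} [CommRing R]

lemma extZero_succ_iff_subsingleton (M N : ModuleCat.{u} R) (n : ℕ) :
    extZero R M N (n + 1) ↔ Subsingleton (Abelian.Ext.{u} M N (n + 1)) := by
  let P : ProjectiveResolution M := projectiveResolution M
  have h : extZero R M N (n + 1) ↔ ∀ f : P.complex.X (n + 1) ⟶ N,
      P.complex.d (n + 2) (n + 1) ≫ f = 0 → ∃ g, P.complex.d (n + 1) n ≫ g = f := by
    rw [extZero, (P.isoExt (R := R) (n + 1) N).toLinearEquiv.toEquiv.subsingleton_congr,
      ← ModuleCat.isZero_iff_subsingleton, ← HomologicalComplex.exactAt_iff_isZero_homology,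
      HomologicalComplex.exactAt_iff' _ n (n + 1) (n + 2) (by simp) (by simp),
      ShortComplex.moduleCat_exact_iff]
    rfl
  rw [h]
  constructor
  · intro H
    refine subsingleton_of_forall_eq 0 fun α ↦ ?_
    obtain ⟨f, hf, rfl⟩ := P.extMk_surjective α (n + 2) rfl
    exact (P.extMk_eq_zero_iff f _ rfl hf n rfl).2 (H f hf)
  · intro H f hf
    exact (P.extMk_eq_zero_iff f _ rfl hf n rfl).1 (Subsingleton.elim _ _)

lemma extZero_congr {M M' : ModuleCat.{u} R} (e : M ≅ M') (N : ModuleCat.{u} R) (i : ℕ) :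
    extZero R M N i ↔ extZero R M' N i :=
  (((Ext R (ModuleCat.{u} R) i).mapIso e.op).app N).toLinearEquiv.toEquiv.subsingleton_congr.symm

section ShortExact

/-- Dimension shifting in positive degrees. -/
lemma extZero_add_two_iff_of_shortExact {S : ShortComplex (ModuleCat.{u} R)} (hS : S.ShortExact)
    [Projective S.X₂] (N : ModuleCat.{u} R) (n : ℕ) :
    extZero R S.X₃ N (n + 2) ↔ extZero R S.X₁ N (n + 1) := by
  have hn : 1 + (n + 1) = n + 1 + 1 := by omega
  rw [extZero_succ_iff_subsingleton, extZero_succ_iff_subsingleton]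
  constructor <;> intro H <;> refine subsingleton_of_forall_eq 0 fun x ↦ ?_
  · obtain ⟨y, rfl⟩ := Abelian.Ext.contravariant_sequence_exact₁ hS N x hn (Subsingleton.elim _ _)
    rw [Abelian.Ext.eq_zero_of_projective y, Abelian.Ext.comp_zero]
  · obtain ⟨y, rfl⟩ := Abelian.Ext.contravariant_sequence_exact₃ hS N x
      (Abelian.Ext.eq_zero_of_projective _) hn
    rw [Subsingleton.elim y 0, Abelian.Ext.comp_zero]

lemma extZero_one_iff_of_shortExact {S : ShortComplex (ModuleCat.{u} R)} (hS : S.ShortExact)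
    [Projective S.X₂] (N : ModuleCat.{u} R) :
    extZero R S.X₃ N 1 ↔ ∀ φ : S.X₁ ⟶ N, ∃ ψ : S.X₂ ⟶ N, S.f ≫ ψ = φ := by
  have h01 : 1 + 0 = 0 + 1 := rfl
  rw [extZero_succ_iff_subsingleton]
  constructor
  · intro H φ
    obtain ⟨y, hy⟩ := Abelian.Ext.contravariant_sequence_exact₁ hS N (Abelian.Ext.mk₀ φ) h01
      (Subsingleton.elim _ _)
    obtain ⟨ψ, rfl⟩ := (Abelian.Ext.mk₀_bijective _ _).2 y
    rw [Abelian.Ext.mk₀_comp_mk₀] at hy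
    exact ⟨ψ, (Abelian.Ext.mk₀_bijective _ _).1 hy⟩
  · intro H
    refine subsingleton_of_forall_eq 0 fun x ↦ ?_
    obtain ⟨y, rfl⟩ := Abelian.Ext.contravariant_sequence_exact₃ hS N x
      (Abelian.Ext.eq_zero_of_projective _) h01
    obtain ⟨φ, rfl⟩ := (Abelian.Ext.mk₀_bijective _ _).2 y
    obtain ⟨ψ, rfl⟩ := H φ
    rw [← Abelian.Ext.mk₀_comp_mk₀, hS.extClass_comp_assoc]

variable {K P M : Type u} [AddCommGroup K] [Module R K] [AddCommGroup P] [Module R P]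
  [AddCommGroup M] [Module R M] [Module.Projective R P] {i : K →ₗ[R] P} {f : P →ₗ[R] M}

lemma extZero_add_two_iff (hi : Function.Injective i) (hf : Function.Surjective f)
    (h : Function.Exact i f) (N : ModuleCat.{u} R) (n : ℕ) :
    extZero R (ModuleCat.of R M) N (n + 2) ↔ extZero R (ModuleCat.of R K) N (n + 1) := by
  let S := ShortComplex.moduleCatMk i f h.linearMap_comp_eq_zero
  have : Projective S.X₂ := (IsProjective.iff_projective P).1 inferInstance
  exact extZero_add_two_iff_of_shortExact (S := S) (ModuleCat.shortComplex_shortExact _ h hi hf) N n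

lemma extZero_one_iff (hi : Function.Injective i) (hf : Function.Surjective f)
    (h : Function.Exact i f) :
    extZero R (ModuleCat.of R M) (ModuleCat.of R R) 1 ↔ Function.Surjective i.dualMap := by
  let S := ShortComplex.moduleCatMk i f h.linearMap_comp_eq_zero
  have : Projective S.X₂ := (IsProjective.iff_projective P).1 inferInstance
  refine (extZero_one_iff_of_shortExact (S := S) (ModuleCat.shortComplex_shortExact _ h hi hf)
    (ModuleCat.of R R)).trans ⟨fun H φ ↦ ?_, fun H φ ↦ ?_⟩
  · obtain ⟨ψ, hψ⟩ := H (ModuleCat.ofHom φ)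
    exact ⟨ψ.hom, congrArg ModuleCat.Hom.hom hψ⟩
  · obtain ⟨ψ, hψ⟩ := H φ.hom
    exact ⟨ModuleCat.ofHom ψ, ModuleCat.hom_ext hψ⟩

end ShortExact

end Ext

section IsFP

variable {R : Type u} [CommRing R]

lemma IsFP.finite {n : ℕ} {M : ModuleCat.{u} R} (h : IsFP R n M) : Module.Finite R M := by
  cases n with
  | zero => exact h
  | succ n =>
    obtain ⟨k, f, hf, -⟩ := h
    exact Module.Finite.of_surjective f hf

lemma IsFP.finitePresentation {n : ℕ} {M : ModuleCat.{u} R} (h : IsFP R (n + 1) M) :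
    Module.FinitePresentation R M := by
  obtain ⟨k, f, hf, hK⟩ := h
  have := hK.finite
  exact Module.finitePresentation_of_surjective f hf (Module.Finite.iff_fg.1 this)

variable (S : Submonoid R) (Rₛ : Type u) [CommRing Rₛ] [Algebra R Rₛ] [IsLocalization S Rₛ]

lemma IsFP.of_isLocalizedModule (n : ℕ) {M M' : Type u} [AddCommGroup M] [Module R M]
    [AddCommGroup M'] [Module R M'] [Module Rₛ M'] [IsScalarTower R Rₛ M']
    (g : M →ₗ[R] M') [IsLocalizedModule S g] (h : IsFP R n (ModuleCat.of R M)) :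
    IsFP Rₛ n (ModuleCat.of Rₛ M') := by
  induction n generalizing M M' with
  | zero =>
    have : Module.Finite R M := h
    exact Module.Finite.of_isLocalizedModule S g
  | succ n ih =>
    obtain ⟨k, f, hf, hK⟩ := h
    let p : (Fin k → R) →ₗ[R] (Fin k → Rₛ) := .pi fun i ↦ Algebra.linearMap R Rₛ ∘ₗ .proj i
    have : IsLocalizedModule S p := inferInstance
    let f' := IsLocalizedModule.mapExtendScalars S p g Rₛ f
    refine ⟨k, f', IsLocalizedModule.map_surjective S p g f hf, ?_⟩
    let q : LinearMap.ker f →ₗ[R] LinearMap.ker f' := LinearMap.toKerIsLocalized S p g f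
    have : IsLocalizedModule S q := LinearMap.toKerLocalized_isLocalizedModule Rₛ S p g f
    exact ih q hK

end IsFP

section Dual

lemma dual_ext_of_isLocalizedModule {R : Type*} [CommRing R] (S : Submonoid R) {Rₛ : Type*}
    [CommRing Rₛ] [Algebra R Rₛ] [IsLocalization S Rₛ] {M M' : Type*} [AddCommGroup M] [Module R M]
    [AddCommGroup M'] [Module R M'] [Module Rₛ M'] [IsScalarTower R Rₛ M']
    (f : M →ₗ[R] M') [IsLocalizedModule S f] {φ ψ : Module.Dual Rₛ M'}
    (h : ∀ x, φ (f x) = ψ (f x)) : φ = ψ := by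
  apply LinearMap.restrictScalars_injective R
  apply IsLocalizedModule.linearMap_ext S f (Algebra.linearMap R Rₛ)
  ext x
  exact h x

variable {R : Type u} [CommRing R] (S : Submonoid R) (Rₛ : Type u) [CommRing Rₛ] [Algebra R Rₛ]
  [IsLocalization S Rₛ] {M M' N N' : Type u} [AddCommGroup M] [Module R M]
  [AddCommGroup M'] [Module R M'] [Module Rₛ M'] [IsScalarTower R Rₛ M']
  (f : M →ₗ[R] M') [IsLocalizedModule S f] [AddCommGroup N] [Module R N]
  [AddCommGroup N'] [Module R N'] [Module Rₛ N'] [IsScalarTower R Rₛ N']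
  (g : N →ₗ[R] N') [IsLocalizedModule S g]

/-- The localization of linear forms on `M` to linear forms on the localized module `M'`. -/
noncomputable def localizedDual : Module.Dual R M →ₗ[R] Module.Dual Rₛ M' :=
  IsLocalizedModule.mapExtendScalars S f (Algebra.linearMap R Rₛ) Rₛ

@[simp]
lemma localizedDual_apply_apply (φ : Module.Dual R M) (x : M) :
    localizedDual S Rₛ f φ (f x) = algebraMap R Rₛ (φ x) :=
  IsLocalizedModule.map_apply S f (Algebra.linearMap R Rₛ) φ x

instance [Module.FinitePresentation R M] : IsLocalizedModule S (localizedDual S Rₛ f) :=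
  Module.FinitePresentation.isLocalizedModule_mapExtendScalars ..

lemma map_dualMap_eq [Module.FinitePresentation R M] [Module.FinitePresentation R N]
    (i : M →ₗ[R] N) :
    IsLocalizedModule.map S (localizedDual S Rₛ g) (localizedDual S Rₛ f) i.dualMap =
      (IsLocalizedModule.mapExtendScalars S f g Rₛ i).dualMap.restrictScalars R := by
  apply IsLocalizedModule.linearMap_ext S (localizedDual S Rₛ g) (localizedDual S Rₛ f)
  ext1 φ
  refine dual_ext_of_isLocalizedModule S f fun x ↦ ?_
  simp

lemma map_dualEval_eq [Module.FinitePresentation R M]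
    [Module.FinitePresentation R (Module.Dual R M)] :
    IsLocalizedModule.map S f (localizedDual S Rₛ (localizedDual S Rₛ f)) (Module.Dual.eval R M) =
      (Module.Dual.eval Rₛ M').restrictScalars R := by
  apply IsLocalizedModule.linearMap_ext S f (localizedDual S Rₛ (localizedDual S Rₛ f))
  ext1 x
  refine dual_ext_of_isLocalizedModule S (localizedDual S Rₛ f) fun φ ↦ ?_
  simp

/-- Localization commutes with duals of finitely presented modules. -/
noncomputable def localizedModuleDualEquiv [Module.FinitePresentation R M] :
    LocalizedModule S (Module.Dual R M) ≃ₗ[Localization S]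
      Module.Dual (Localization S) (LocalizedModule S M) :=
  (IsLocalizedModule.iso S (localizedDual S (Localization S)
    (LocalizedModule.mkLinearMap S M))).extendScalarsOfIsLocalization S (Localization S)

lemma extZero_localizedModule_dual_iff [Module.FinitePresentation R M]
    (L : ModuleCat.{u} (Localization S)) (i : ℕ) :
    extZero (Localization S) (ModuleCat.of (Localization S) (LocalizedModule S (Module.Dual R M)))
      L i ↔
    extZero (Localization S) (ModuleCat.of (Localization S)
      (Module.Dual (Localization S) (LocalizedModule S M))) L i :=
  extZero_congr (localizedModuleDualEquiv S).toModuleIso L i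

end Dual

section LocalizedModule

variable {R : Type u} [CommRing R] (S : Submonoid R) {K P M : Type u} [AddCommGroup K] [Module R K]
  [AddCommGroup P] [Module R P] [AddCommGroup M] [Module R M] [Module.Projective R P]
  {i : K →ₗ[R] P} {f : P →ₗ[R] M}

lemma extZero_one_localizedModule_iff (hi : Function.Injective i) (hf : Function.Surjective f)
    (h : Function.Exact i f) :
    extZero (Localization S) (ModuleCat.of (Localization S) (LocalizedModule S M))
      (ModuleCat.of (Localization S) (Localization S)) 1 ↔
      Function.Surjective (LocalizedModule.map S i).dualMap :=
  extZero_one_iff (LocalizedModule.map_injective S i hi) (LocalizedModule.map_surjective S f hf)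
    (LocalizedModule.map_exact S i f h)

lemma extZero_add_two_localizedModule_iff (hi : Function.Injective i) (hf : Function.Surjective f)
    (h : Function.Exact i f) (N : ModuleCat.{u} (Localization S)) (n : ℕ) :
    extZero (Localization S) (ModuleCat.of (Localization S) (LocalizedModule S M)) N (n + 2) ↔
      extZero (Localization S) (ModuleCat.of (Localization S) (LocalizedModule S K)) N (n + 1) :=
  extZero_add_two_iff (LocalizedModule.map_injective S i hi) (LocalizedModule.map_surjective S f hf)
    (LocalizedModule.map_exact S i f h) N n

end LocalizedModule

section Maximal

variable {R : Type u} [CommRing R]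

lemma surjective_dualMap_iff {M N : Type u} [AddCommGroup M] [Module R M] [AddCommGroup N]
    [Module R N] [Module.FinitePresentation R M] [Module.FinitePresentation R N]
    (i : M →ₗ[R] N) :
    Function.Surjective i.dualMap ↔ ∀ (m : Ideal R) [m.IsMaximal],
      Function.Surjective (LocalizedModule.map m.primeCompl i).dualMap := by
  have key (m : Ideal R) [m.IsMaximal] := map_dualMap_eq m.primeCompl (Localization.AtPrime m)
    (LocalizedModule.mkLinearMap m.primeCompl M) (LocalizedModule.mkLinearMap m.primeCompl N) i
  constructor
  · intro h m _
    have := IsLocalizedModule.map_surjective m.primeCompl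
      (localizedDual m.primeCompl (Localization.AtPrime m)
        (LocalizedModule.mkLinearMap m.primeCompl N))
      (localizedDual m.primeCompl (Localization.AtPrime m)
        (LocalizedModule.mkLinearMap m.primeCompl M)) i.dualMap h
    rwa [key m] at this
  · intro h
    refine surjective_of_isLocalized_maximal
      (fun m _ ↦ Module.Dual (Localization.AtPrime m) (LocalizedModule m.primeCompl N))
      (fun m _ ↦ localizedDual m.primeCompl (Localization.AtPrime m)
        (LocalizedModule.mkLinearMap m.primeCompl N))
      (fun m _ ↦ Module.Dual (Localization.AtPrime m) (LocalizedModule m.primeCompl M))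
      (fun m _ ↦ localizedDual m.primeCompl (Localization.AtPrime m)
        (LocalizedModule.mkLinearMap m.primeCompl M)) _ fun m _ ↦ ?_
    rw [key m]
    exact h m

lemma isReflexive_iff_localizations {M : Type u} [AddCommGroup M] [Module R M]
    [Module.FinitePresentation R M] [Module.FinitePresentation R (Module.Dual R M)] :
    Module.IsReflexive R M ↔ ∀ (m : Ideal R) [m.IsMaximal],
      Module.IsReflexive (Localization.AtPrime m) (LocalizedModule m.primeCompl M) := by
  have key (m : Ideal R) [m.IsMaximal] := map_dualEval_eq m.primeCompl (Localization.AtPrime m)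
    (LocalizedModule.mkLinearMap m.primeCompl M)
  constructor
  · intro h m _
    have inj := IsLocalizedModule.map_injective m.primeCompl
      (LocalizedModule.mkLinearMap m.primeCompl M)
      (localizedDual m.primeCompl (Localization.AtPrime m)
        (localizedDual m.primeCompl (Localization.AtPrime m)
          (LocalizedModule.mkLinearMap m.primeCompl M))) _ h.bijective_dual_eval'.1
    have surj := IsLocalizedModule.map_surjective m.primeCompl
      (LocalizedModule.mkLinearMap m.primeCompl M)
      (localizedDual m.primeCompl (Localization.AtPrime m)
        (localizedDual m.primeCompl (Localization.AtPrime m)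
          (LocalizedModule.mkLinearMap m.primeCompl M))) _ h.bijective_dual_eval'.2
    rw [key m] at inj surj
    exact ⟨inj, surj⟩
  · intro h
    refine ⟨bijective_of_isLocalized_maximal
      (fun m _ ↦ LocalizedModule m.primeCompl M)
      (fun m _ ↦ LocalizedModule.mkLinearMap m.primeCompl M)
      (fun m _ ↦ Module.Dual (Localization.AtPrime m)
        (Module.Dual (Localization.AtPrime m) (LocalizedModule m.primeCompl M)))
      (fun m _ ↦ localizedDual m.primeCompl (Localization.AtPrime m)
        (localizedDual m.primeCompl (Localization.AtPrime m)
          (LocalizedModule.mkLinearMap m.primeCompl M))) _ fun m _ ↦ ?_⟩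
    rw [key m]
    exact (h m).bijective_dual_eval'

lemma extZero_iff_localizations (n : ℕ) {M : Type u} [AddCommGroup M] [Module R M]
    (hM : IsFP R (n + 2) (ModuleCat.of R M)) :
    extZero R (ModuleCat.of R M) (ModuleCat.of R R) (n + 1) ↔
      ∀ (m : Ideal R) [m.IsMaximal],
        extZero (Localization.AtPrime m)
          (ModuleCat.of (Localization.AtPrime m) (LocalizedModule m.primeCompl M))
          (ModuleCat.of (Localization.AtPrime m) (Localization.AtPrime m)) (n + 1) := by
  induction n generalizing M with
  | zero =>
    obtain ⟨k, f, hf, hK⟩ := hM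
    have : Module.FinitePresentation R (LinearMap.ker f) := hK.finitePresentation
    have hi := (LinearMap.ker f).injective_subtype
    have hex := f.exact_subtype_ker_map
    refine (extZero_one_iff hi hf hex).trans ((surjective_dualMap_iff _).trans ?_)
    exact forall₂_congr fun m _ ↦ (extZero_one_localizedModule_iff m.primeCompl hi hf hex).symm
  | succ n ih =>
    obtain ⟨k, f, hf, hK⟩ := hM
    have hi := (LinearMap.ker f).injective_subtype
    have hex := f.exact_subtype_ker_map
    refine (extZero_add_two_iff hi hf hex _ n).trans ((ih hK).trans ?_)
    exact forall₂_congr fun m _ ↦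
      (extZero_add_two_localizedModule_iff m.primeCompl hi hf hex _ n).symm

end Maximal

end AB

theorem memGtilde_iff_localizations (R : Type u) [CommRing R] (M : Type u)
    [AddCommGroup M] [Module R M]
    (h1 : AB.IsFPInf R (ModuleCat.of R M))
    (h2 : AB.IsFPInf R (ModuleCat.of R (Module.Dual R M))) :
    AB.MemGtilde R (ModuleCat.of R M) ↔
      ∀ (m : Ideal R) (_ : m.IsMaximal),
        AB.MemGtilde (Localization.AtPrime m)
          (ModuleCat.of (Localization.AtPrime m) (LocalizedModule m.primeCompl M)) := by
  have : Module.FinitePresentation R M := (h1 1).finitePresentation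
  have : Module.FinitePresentation R (Module.Dual R M) := (h2 1).finitePresentation
  have extZero_pos_iff {N : Type u} [AddCommGroup N] [Module R N]
      (hN : AB.IsFPInf R (ModuleCat.of R N)) :
      (∀ i > 0, AB.extZero R (ModuleCat.of R N) (ModuleCat.of R R) i) ↔
        ∀ (m : Ideal R) [m.IsMaximal], ∀ i > 0, AB.extZero (Localization.AtPrime m)
          (ModuleCat.of (Localization.AtPrime m) (LocalizedModule m.primeCompl N))
          (ModuleCat.of (Localization.AtPrime m) (Localization.AtPrime m)) i := by
    constructor
    · rintro h m _ (_ | i) hi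
      · omega
      · exact (AB.extZero_iff_localizations i (hN _)).1 (h _ hi) m
    · rintro h (_ | i) hi
      · omega
      · exact (AB.extZero_iff_localizations i (hN _)).2 fun m _ ↦ h m _ hi
  have extZero_dual_iff (m : Ideal R) [m.IsMaximal] (i : ℕ) :=
    AB.extZero_localizedModule_dual_iff m.primeCompl (M := M)
      (ModuleCat.of (Localization.AtPrime m) (Localization.AtPrime m)) i
  constructor
  · rintro ⟨⟨-, hrefl, hext, hext'⟩, -⟩ m _
    have hM (n : ℕ) := AB.IsFP.of_isLocalizedModule m.primeCompl (Localization.AtPrime m) n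
      (LocalizedModule.mkLinearMap m.primeCompl M) (h1 n)
    exact ⟨⟨(hM 0).finite, AB.isReflexive_iff_localizations.1 hrefl m,
      (extZero_pos_iff h1).1 hext m,
      fun i hi ↦ (extZero_dual_iff m i).1 ((extZero_pos_iff h2).1 hext' m i hi)⟩, hM,
      fun n ↦ AB.IsFP.of_isLocalizedModule m.primeCompl (Localization.AtPrime m) n
        (AB.localizedDual m.primeCompl (Localization.AtPrime m)
          (LocalizedModule.mkLinearMap m.primeCompl M)) (h2 n)⟩
  · intro h
    refine ⟨⟨inferInstance, AB.isReflexive_iff_localizations.2 fun m _ ↦ (h m ‹_›).1.2.1,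
      (extZero_pos_iff h1).2 fun m _ ↦ (h m ‹_›).1.2.2.1,
      (extZero_pos_iff h2).2 fun m _ i hi ↦
        (extZero_dual_iff m i).2 ((h m ‹_›).1.2.2.2 i hi)⟩, h1, h2⟩
end

section
/- Let M be in G̃(R) and x ∈ R a non-zero-divisor on R. Then M/xM is in the restricted G-class G̃(R/(x)) of R/(x). -/
open CategoryTheory Opposite TensorProduct

universe u

namespace AB

section ExtVanishing

variable {R : Type u} [CommRing R]

/-- In positive degrees, the vanishing of the derived functor `Ext` amounts to cocycles being
coboundaries in a projective resolution. -/
theorem extZero_succ_iff_resolution {M : ModuleCat.{u} R} (P : ProjectiveResolution M)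
    (N : ModuleCat.{u} R) (n : ℕ) :
    extZero R M N (n + 1) ↔ ∀ f : P.complex.X (n + 1) ⟶ N, P.complex.d (n + 2) (n + 1) ≫ f = 0 →
      ∃ g : P.complex.X n ⟶ N, P.complex.d (n + 1) n ≫ g = f := by
  rw [extZero, ext, (P.isoExt (R := R) (n + 1) N).toLinearEquiv.toEquiv.subsingleton_congr,
    ← ModuleCat.isZero_iff_subsingleton, ← HomologicalComplex.exactAt_iff_isZero_homology,
    HomologicalComplex.exactAt_iff' _ n (n + 1) (n + 2) (by simp) (by simp),
    ShortComplex.moduleCat_exact_iff]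
  rfl

theorem extZero_succ_iff {M N : ModuleCat.{u} R} (n : ℕ) :
    extZero R M N (n + 1) ↔ ∀ e : Abelian.Ext M N (n + 1), e = 0 := by
  let P := ProjectiveResolution.of M
  rw [extZero_succ_iff_resolution P]
  constructor
  · intro h e
    obtain ⟨f, hf, rfl⟩ := P.extMk_surjective e (n + 2) rfl
    exact (P.extMk_eq_zero_iff f _ rfl hf n rfl).2 (h f hf)
  · intro h f hf
    exact (P.extMk_eq_zero_iff f _ rfl hf n rfl).1 (h _)

variable {P M : Type u} [AddCommGroup P] [Module R P] [AddCommGroup M] [Module R M]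
  {N : Type u} [AddCommGroup N] [Module R N]

theorem extZero_one_iff_s12 [Module.Projective R P] {f : P →ₗ[R] M} (hf : Function.Surjective f) :
    extZero R (ModuleCat.of R M) (ModuleCat.of R N) 1 ↔
      ∀ g : LinearMap.ker f →ₗ[R] N, ∃ h : P →ₗ[R] N, h ∘ₗ (LinearMap.ker f).subtype = g := by
  have hS := LinearMap.shortExact_shortComplexKer hf
  have : Projective f.shortComplexKer.X₂ := inferInstanceAs (Projective (ModuleCat.of R P))
  rw [show (1 : ℕ) = 0 + 1 from rfl, extZero_succ_iff]
  constructor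
  · intro H g
    obtain ⟨y, hy⟩ := Abelian.Ext.contravariant_sequence_exact₁ hS (ModuleCat.of R N)
      (Abelian.Ext.mk₀ (ModuleCat.ofHom g)) (add_zero 1) (H _)
    obtain ⟨h, rfl⟩ := Abelian.Ext.homEquiv₀.symm.surjective y
    refine ⟨h.hom, ?_⟩
    rw [Abelian.Ext.homEquiv₀_symm_apply, Abelian.Ext.mk₀_comp_mk₀] at hy
    have := Abelian.Ext.homEquiv₀.symm.injective hy
    exact congrArg ModuleCat.Hom.hom this
  · intro H e
    obtain ⟨y, rfl⟩ := Abelian.Ext.contravariant_sequence_exact₃ hS (ModuleCat.of R N) e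
      (Abelian.Ext.eq_zero_of_projective _) (add_zero 1)
    obtain ⟨g, rfl⟩ := Abelian.Ext.homEquiv₀.symm.surjective y
    obtain ⟨h, hh⟩ := H g.hom
    have : g = f.shortComplexKer.f ≫ ModuleCat.ofHom h := ModuleCat.hom_ext hh.symm
    rw [this, Abelian.Ext.homEquiv₀_symm_apply, ← Abelian.Ext.mk₀_comp_mk₀,
      hS.extClass_comp_assoc]

theorem extZero_add_two_iff_s12 [Module.Projective R P] {f : P →ₗ[R] M} (hf : Function.Surjective f)
    (n : ℕ) :
    extZero R (ModuleCat.of R M) (ModuleCat.of R N) (n + 2) ↔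
      extZero R (ModuleCat.of R (LinearMap.ker f)) (ModuleCat.of R N) (n + 1) := by
  have hS := LinearMap.shortExact_shortComplexKer hf
  have : Projective f.shortComplexKer.X₂ := inferInstanceAs (Projective (ModuleCat.of R P))
  rw [extZero_succ_iff, extZero_succ_iff]
  constructor
  · intro H e
    obtain ⟨y, rfl⟩ := Abelian.Ext.contravariant_sequence_exact₁ hS (ModuleCat.of R N)
      e (add_comm _ _) (H _)
    rw [Abelian.Ext.eq_zero_of_projective y, Abelian.Ext.comp_zero]
  · intro H e
    obtain ⟨y, rfl⟩ := Abelian.Ext.contravariant_sequence_exact₃ hS (ModuleCat.of R N) e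
      (Abelian.Ext.eq_zero_of_projective _) (add_comm _ _)
    rw [H y, Abelian.Ext.comp_zero]

end ExtVanishing

/-- An `R`-linear map `p : M → N` exhibits `N` as the quotient `M / xM`. -/
structure IsReduction {R M N : Type*} [CommRing R] [AddCommGroup M] [Module R M]
    [AddCommGroup N] [Module R N] (x : R) (p : M →ₗ[R] N) : Prop where
  surjective : Function.Surjective p
  eq_zero_iff : ∀ m, p m = 0 ↔ ∃ m', x • m' = m

/-- A linear map whose values are all divisible by a regular element is a multiple of it. -/
theorem exists_eq_smul_of_forall_dvd {R M N : Type*} [CommRing R] [AddCommGroup M] [Module R M]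
    [AddCommGroup N] [Module R N] {x : R} (hN : IsSMulRegular N x) (f : M →ₗ[R] N)
    (hf : ∀ m, ∃ n, x • n = f m) : ∃ g : M →ₗ[R] N, x • g = f := by
  choose g hg using hf
  refine ⟨{ toFun := g, map_add' := fun a b => hN ?_, map_smul' := fun r a => hN ?_ },
    LinearMap.ext hg⟩
  · simp only [smul_add, hg, map_add]
  · simp only [RingHom.id_apply, smul_comm x r, hg, map_smul]

/-- A linear map vanishing on the kernel of a surjection factors through it. -/
theorem exists_comp_eq_of_ker_le {R P M N : Type*} [CommRing R] [AddCommGroup P] [Module R P]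
    [AddCommGroup M] [Module R M] [AddCommGroup N] [Module R N] {f : P →ₗ[R] M}
    (hf : Function.Surjective f) (g : P →ₗ[R] N) (hg : LinearMap.ker f ≤ LinearMap.ker g) :
    ∃ h : M →ₗ[R] N, ∀ m, h (f m) = g m :=
  ⟨(LinearMap.ker f).liftQ g hg ∘ₗ (f.quotKerEquivOfSurjective hf).symm, fun m => by
    have : (f.quotKerEquivOfSurjective hf).symm (f m) = (LinearMap.ker f).mkQ m := by
      rw [LinearEquiv.symm_apply_eq]; rfl
    simp [this]⟩

theorem isSMulRegular_dual {R M : Type*} [CommRing R] [AddCommGroup M] [Module R M] {x : R}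
    (hR : IsSMulRegular R x) : IsSMulRegular (Module.Dual R M) x :=
  fun _ _ h => LinearMap.ext fun m => hR (LinearMap.congr_fun h m)

theorem isSMulRegular_of_isReflexive {R M : Type*} [CommRing R] [AddCommGroup M] [Module R M]
    [Module.IsReflexive R M] {x : R} (hR : IsSMulRegular R x) : IsSMulRegular M x := by
  refine fun a b h => (Module.bijective_dual_eval R M).1 (LinearMap.ext fun φ => hR ?_)
  simpa using congrArg φ h

/-- If `Ext¹(M, N) = 0`, maps from `M` to `N / xN` lift to `N`. -/
theorem IsReduction.exists_lift_of_extZero {R : Type u} [CommRing R] {M N N' : Type u}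
    [AddCommGroup M] [Module R M] [AddCommGroup N] [Module R N] [AddCommGroup N'] [Module R N']
    {x : R} {q : N →ₗ[R] N'} (hq : IsReduction x q) (hN : IsSMulRegular N x)
    (hM : extZero R (ModuleCat.of R M) (ModuleCat.of R N) 1) (φ : M →ₗ[R] N') :
    ∃ Φ : M →ₗ[R] N, ∀ m, q (Φ m) = φ m := by
  let f : (M →₀ R) →ₗ[R] M := Finsupp.linearCombination R id
  have hf : Function.Surjective f := Finsupp.linearCombination_id_surjective R M
  obtain ⟨ψ, hψ⟩ := Module.projective_lifting_property q (φ ∘ₗ f) hq.surjective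
  have hψ' (v) : q (ψ v) = φ (f v) := LinearMap.congr_fun hψ v
  obtain ⟨g, hg⟩ := exists_eq_smul_of_forall_dvd (M := LinearMap.ker f) hN
    (ψ ∘ₗ (LinearMap.ker f).subtype) fun k => (hq.eq_zero_iff _).1 (by simp [hψ'])
  obtain ⟨h, rfl⟩ := (extZero_one_iff_s12 hf).1 hM g
  obtain ⟨Φ, hΦ⟩ := exists_comp_eq_of_ker_le hf (ψ - x • h) fun k hk => by
    simpa [sub_eq_zero] using (LinearMap.congr_fun hg ⟨k, hk⟩).symm
  refine ⟨Φ, fun m => ?_⟩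
  obtain ⟨v, rfl⟩ := hf m
  rw [hΦ, LinearMap.sub_apply, map_sub, hψ', (hq.eq_zero_iff ((x • h) v)).2 ⟨h v, rfl⟩, sub_zero]

section Reduction

variable {R S : Type u} [CommRing R] [CommRing S] [Algebra R S] {x : R}
  {M M' : Type u} [AddCommGroup M] [Module R M] [AddCommGroup M'] [Module R M'] [Module S M']
  {N N' : Type u} [AddCommGroup N] [Module R N] [AddCommGroup N'] [Module R N'] [Module S N']
  [IsScalarTower R S N']

theorem IsReduction.pi (hS : IsReduction x (Algebra.linearMap R S)) (k : ℕ) :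
    IsReduction x ((Algebra.linearMap R S).compLeft (Fin k)) where
  surjective v := by
    choose w hw using fun i => hS.surjective (v i)
    exact ⟨w, funext hw⟩
  eq_zero_iff v := by
    constructor
    · intro h
      choose w hw using fun i => (hS.eq_zero_iff (v i)).1 (congrFun h i)
      exact ⟨w, funext hw⟩
    · rintro ⟨w, rfl⟩
      exact funext fun i => (hS.eq_zero_iff _).2 ⟨w i, rfl⟩

/-- Reduction modulo `x` preserves kernels of surjections onto `x`-torsion-free modules. -/
theorem IsReduction.exists_ker {p : M →ₗ[R] M'} (hp : IsReduction x p) {q : N →ₗ[R] N'}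
    (hq : IsReduction x q) (hM : IsSMulRegular M x) {f : N →ₗ[R] M} (hf : Function.Surjective f)
    {f' : N' →ₗ[S] M'} (hf' : ∀ n, f' (q n) = p (f n)) :
    ∃ κ : LinearMap.ker f →ₗ[R] LinearMap.ker f', IsReduction x κ ∧ ∀ k, (κ k : N') = q k := by
  let κ : LinearMap.ker f →ₗ[R] LinearMap.ker f' :=
    (q ∘ₗ (LinearMap.ker f).subtype).codRestrict ((LinearMap.ker f').restrictScalars R)
      fun k => by simp [hf']
  refine ⟨κ, ⟨?_, ?_⟩, fun k => rfl⟩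
  · rintro ⟨v, hv⟩
    obtain ⟨w, rfl⟩ := hq.surjective v
    rw [LinearMap.mem_ker, hf', hp.eq_zero_iff] at hv
    obtain ⟨m, hm⟩ := hv
    obtain ⟨u, rfl⟩ := hf m
    refine ⟨⟨w - x • u, by simp [hm]⟩, Subtype.ext ?_⟩
    change q (w - x • u) = q w
    rw [map_sub, (hq.eq_zero_iff (x • u)).2 ⟨u, rfl⟩, sub_zero]
  · intro k
    rw [← Subtype.coe_inj]
    change q k = 0 ↔ _
    rw [hq.eq_zero_iff]
    constructor
    · rintro ⟨n, hn⟩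
      refine ⟨⟨n, hM ?_⟩, Subtype.ext hn⟩
      simp only [smul_zero, ← map_smul, hn, LinearMap.map_coe_ker]
    · rintro ⟨n, rfl⟩
      exact ⟨n, rfl⟩

variable [IsScalarTower R S M']

theorem IsReduction.smul_eq_zero (hS : IsReduction x (Algebra.linearMap R S)) (m : M') :
    x • m = 0 := by
  have : algebraMap R S x = 0 := (hS.eq_zero_iff x).2 ⟨1, by simp⟩
  rw [← algebraMap_smul S, this, zero_smul]

/-- An `R`-linear map from `M` to an `R / x`-module factors through `M / xM`. -/
theorem IsReduction.exists_desc (hS : IsReduction x (Algebra.linearMap R S)) {p : M →ₗ[R] M'}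
    (hp : IsReduction x p) (g : M →ₗ[R] N') : ∃ h : M' →ₗ[S] N', ∀ m, h (p m) = g m := by
  obtain ⟨h, hh⟩ := exists_comp_eq_of_ker_le hp.surjective g fun m hm => by
    obtain ⟨m, rfl⟩ := (hp.eq_zero_iff _).1 hm
    simp [hS.smul_eq_zero]
  exact ⟨h.extendScalarsOfSurjective hS.surjective, hh⟩

theorem isSMulRegular_ker_pi (hR : IsSMulRegular R x) {k : ℕ} (f : (Fin k → R) →ₗ[R] M) :
    IsSMulRegular (LinearMap.ker f) x :=
  fun _ _ h => Subtype.ext (funext fun i => hR (congrFun (congrArg Subtype.val h) i))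

theorem IsReduction.isFP (hS : IsReduction x (Algebra.linearMap R S)) (hR : IsSMulRegular R x)
    (n : ℕ) {M M' : Type u} [AddCommGroup M] [Module R M] [AddCommGroup M'] [Module R M']
    [Module S M'] [IsScalarTower R S M'] {p : M →ₗ[R] M'} (hp : IsReduction x p)
    (hM : IsSMulRegular M x) (h : IsFP R n (ModuleCat.of R M)) :
    IsFP S n (ModuleCat.of S M') := by
  induction n generalizing M M' with
  | zero =>
    have : Module.Finite R M := h
    have := Module.Finite.of_surjective p hp.surjective
    exact Module.Finite.of_restrictScalars_finite R S M'
  | succ n ih =>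
    obtain ⟨k, f, hf, hK⟩ := h
    obtain ⟨f', hf'⟩ := hS.exists_desc (hS.pi k) (p ∘ₗ f)
    obtain ⟨κ, hκ, -⟩ := hp.exists_ker (hS.pi k) hM hf hf'
    refine ⟨k, f', fun m => ?_, ih hκ (isSMulRegular_ker_pi hR f) hK⟩
    obtain ⟨v, rfl⟩ := (hp.surjective.comp hf) m
    exact ⟨_, hf' v⟩

theorem IsReduction.extZero (hS : IsReduction x (Algebra.linearMap R S))
    (hR : IsSMulRegular R x) (n : ℕ) {M M' : Type u} [AddCommGroup M] [Module R M]
    [AddCommGroup M'] [Module R M'] [Module S M'] [IsScalarTower R S M'] {p : M →ₗ[R] M'}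
    (hp : IsReduction x p) (hM : IsSMulRegular M x) (h : IsFP R (n + 1) (ModuleCat.of R M))
    (hE : ∀ i, extZero R (ModuleCat.of R M) (ModuleCat.of R R) (i + 1)) :
    extZero S (ModuleCat.of S M') (ModuleCat.of S S) (n + 1) := by
  induction n generalizing M M' with
  | zero =>
    obtain ⟨k, f, hf, -⟩ := h
    obtain ⟨f', hf'⟩ := hS.exists_desc (hS.pi k) (p ∘ₗ f)
    obtain ⟨κ, hκ, hκq⟩ := hp.exists_ker (hS.pi k) hM hf hf'
    have hf's : Function.Surjective f' := fun m => by
      obtain ⟨v, rfl⟩ := (hp.surjective.comp hf) m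
      exact ⟨_, hf' v⟩
    refine (extZero_one_iff_s12 hf's).2 fun g => ?_
    obtain ⟨G, hG⟩ := hS.exists_lift_of_extZero hR ((extZero_add_two_iff_s12 hf 0).1 (hE 1))
      (g.restrictScalars R ∘ₗ κ)
    obtain ⟨H, rfl⟩ := (extZero_one_iff_s12 hf).1 (hE 0) G
    obtain ⟨h, hh⟩ := hS.exists_desc (hS.pi k) (Algebra.linearMap R S ∘ₗ H)
    refine ⟨h, LinearMap.ext fun v => ?_⟩
    obtain ⟨v, rfl⟩ := hκ.surjective v
    simpa [hκq, hh] using hG v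
  | succ n ih =>
    obtain ⟨k, f, hf, hK⟩ := h
    obtain ⟨f', hf'⟩ := hS.exists_desc (hS.pi k) (p ∘ₗ f)
    obtain ⟨κ, hκ, -⟩ := hp.exists_ker (hS.pi k) hM hf hf'
    have hf's : Function.Surjective f' := fun m => by
      obtain ⟨v, rfl⟩ := (hp.surjective.comp hf) m
      exact ⟨_, hf' v⟩
    exact (extZero_add_two_iff_s12 hf's n).2 (ih hκ (isSMulRegular_ker_pi hR f) hK
      fun i => (extZero_add_two_iff_s12 hf i).1 (hE (i + 1)))

/-- If `Ext¹(M, R) = 0`, the dual of `M / xM` is `M* / xM*`. -/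
theorem IsReduction.exists_dual (hS : IsReduction x (Algebra.linearMap R S))
    (hR : IsSMulRegular R x) {p : M →ₗ[R] M'} (hp : IsReduction x p)
    (hE : AB.extZero R (ModuleCat.of R M) (ModuleCat.of R R) 1) :
    ∃ ρ : Module.Dual R M →ₗ[R] Module.Dual S M', IsReduction x ρ ∧
      ∀ φ m, ρ φ (p m) = algebraMap R S (φ m) := by
  choose ρ hρ using fun φ : Module.Dual R M => hS.exists_desc hp (Algebra.linearMap R S ∘ₗ φ)
  have hext {a b : Module.Dual S M'} (h : ∀ m, a (p m) = b (p m)) : a = b :=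
    LinearMap.ext fun m => by obtain ⟨m, rfl⟩ := hp.surjective m; exact h m
  refine ⟨{ toFun := ρ, map_add' := fun a b => hext fun m => ?_,
            map_smul' := fun r a => hext fun m => ?_ }, ⟨fun φ => ?_, fun φ => ?_⟩, hρ⟩
  · simp [hρ]
  · simp [hρ, Algebra.smul_def]
  · obtain ⟨Φ, hΦ⟩ := hS.exists_lift_of_extZero hR hE (φ.restrictScalars R ∘ₗ p)
    exact ⟨Φ, hext fun m => (hρ Φ m).trans (hΦ m)⟩
  · refine ⟨fun h => exists_eq_smul_of_forall_dvd hR φ fun m => (hS.eq_zero_iff _).1 ?_, ?_⟩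
    · exact (hρ φ m).symm.trans (LinearMap.congr_fun h (p m))
    · rintro ⟨ψ, rfl⟩
      exact hext fun m => (hρ _ m).trans ((hS.eq_zero_iff _).2 ⟨ψ m, rfl⟩)

theorem IsReduction.isReflexive (hS : IsReduction x (Algebra.linearMap R S))
    (hR : IsSMulRegular R x) {p : M →ₗ[R] M'} (hp : IsReduction x p) [Module.IsReflexive R M]
    (hE : AB.extZero R (ModuleCat.of R M) (ModuleCat.of R R) 1)
    (hE' : AB.extZero R (ModuleCat.of R (Module.Dual R M)) (ModuleCat.of R R) 1) :
    Module.IsReflexive S M' := by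
  obtain ⟨ρ, hρ, hρp⟩ := hS.exists_dual hR hp hE
  refine ⟨(injective_iff_map_eq_zero _).2 fun m hm => ?_, fun Φ => ?_⟩
  · obtain ⟨m, rfl⟩ := hp.surjective m
    obtain ⟨θ, hθ⟩ := exists_eq_smul_of_forall_dvd hR (Module.Dual.eval R M m) fun φ =>
      (hS.eq_zero_iff _).1 ((hρp φ m).symm.trans (LinearMap.congr_fun hm (ρ φ)))
    obtain ⟨n, rfl⟩ := (Module.bijective_dual_eval R M).2 θ
    exact (hp.eq_zero_iff m).2 ⟨n, (Module.bijective_dual_eval R M).1 (by rw [map_smul, hθ])⟩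
  · obtain ⟨θ, hθ⟩ := hS.exists_lift_of_extZero hR hE' (Φ.restrictScalars R ∘ₗ ρ)
    obtain ⟨m, rfl⟩ := (Module.bijective_dual_eval R M).2 θ
    refine ⟨p m, LinearMap.ext fun φ => ?_⟩
    obtain ⟨φ, rfl⟩ := hρ.surjective φ
    exact (hρp φ m).trans (hθ φ)

theorem IsReduction.memGtilde (hS : IsReduction x (Algebra.linearMap R S))
    (hR : IsSMulRegular R x) {p : M →ₗ[R] M'} (hp : IsReduction x p)
    (h : MemGtilde R (ModuleCat.of R M)) : MemGtilde S (ModuleCat.of S M') := by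
  obtain ⟨⟨-, hrefl, hE, hE'⟩, hFP, hFP'⟩ := h
  have : Module.IsReflexive R M := hrefl
  have hM : IsSMulRegular M x := isSMulRegular_of_isReflexive hR
  have hM' : IsSMulRegular (Module.Dual R M) x := isSMulRegular_dual hR
  obtain ⟨ρ, hρ, -⟩ := hS.exists_dual hR hp (hE 1 one_pos)
  refine ⟨⟨hS.isFP hR 0 hp hM (hFP 0),
    hS.isReflexive hR hp (hE 1 one_pos) (hE' 1 one_pos), fun i hi => ?_, fun i hi => ?_⟩,
    fun n => hS.isFP hR n hp hM (hFP n), fun n => hS.isFP hR n hρ hM' (hFP' n)⟩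
  · obtain ⟨n, rfl⟩ := Nat.exists_eq_add_one.2 hi
    exact hS.extZero hR n hp hM (hFP _) fun i => hE _ i.succ_pos
  · obtain ⟨n, rfl⟩ := Nat.exists_eq_add_one.2 hi
    exact hS.extZero hR n hρ hM' (hFP' _) fun i => hE' _ i.succ_pos

end Reduction

theorem isReduction_mkQ {R M : Type*} [CommRing R] [AddCommGroup M] [Module R M] (x : R) :
    IsReduction x (Ideal.span {x} • ⊤ : Submodule R M).mkQ where
  surjective := Submodule.mkQ_surjective _
  eq_zero_iff m := by
    rw [Submodule.mkQ_apply, Submodule.Quotient.mk_eq_zero, Submodule.ideal_span_singleton_smul,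
      Submodule.mem_smul_pointwise_iff_exists]
    simp

theorem isReduction_quotient_span {R : Type*} [CommRing R] (x : R) :
    IsReduction x (Algebra.linearMap R (R ⧸ Ideal.span {x})) where
  surjective := Ideal.Quotient.mk_surjective
  eq_zero_iff r := by
    rw [Algebra.linearMap_apply, Ideal.Quotient.algebraMap_eq, Ideal.Quotient.eq_zero_iff_mem,
      Ideal.mem_span_singleton']
    simp [mul_comm]

end AB

theorem memGtilde_quotient_regular_element (R : Type u) [CommRing R] (M : Type u)
    [AddCommGroup M] [Module R M]
    (hM : AB.MemGtilde R (ModuleCat.of R M)) (x : R)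
    (hxR : Function.Injective fun r : R => x * r) :
    AB.MemGtilde (R ⧸ Ideal.span {x})
      (ModuleCat.of (R ⧸ Ideal.span {x})
        (M ⧸ (Ideal.span {x} • ⊤ : Submodule R M))) :=
  (AB.isReduction_quotient_span x).memGtilde hxR (AB.isReduction_mkQ x) hM
end

section
/- Let n ≥ 0 and 0 → M → A_0 → A_1 → ... → A_n → 0 be an exact sequence of R-modules. Suppose for 1 ≤ i ≤ n that Ext^j_R(A_i, R) = 0 for 1 ≤ j ≤ i. Then the dualized sequence 0 → A_n* → A_{n-1}* → ... → A_0* → M* → 0 is exact, where (−)* = Hom_R(−, R). -/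
open CategoryTheory Opposite TensorProduct

universe u

section ExtVanishing

open Abelian

variable {R : Type u} [CommRing R]

namespace AB

/-- Vanishing of `Ext` defined by derived functors implies vanishing of `Ext` defined
by the derived category, in positive degrees. -/
lemma extZero.subsingleton_abelianExt {X Y : ModuleCat.{u} R} {j : ℕ}
    (h : extZero R X Y (j + 1)) : Subsingleton (Abelian.Ext.{u} X Y (j + 1)) := by
  let P := projectiveResolution X
  have hz : Limits.IsZero ((P.complex.linearYonedaObj R Y).homology (j + 1)) :=
    (ModuleCat.isZero_of_iff_subsingleton.2 h).of_iso (P.isoExt (R := R) (j + 1) Y).symm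
  rw [← HomologicalComplex.exactAt_iff_isZero_homology,
    HomologicalComplex.exactAt_iff' _ j (j + 1) (j + 2) (by simp) (by simp),
    ShortComplex.moduleCat_exact_iff] at hz
  refine subsingleton_of_forall_eq 0 fun x ↦ ?_
  obtain ⟨f, hf, rfl⟩ := P.extMk_surjective x (j + 2) rfl
  rw [P.extMk_eq_zero_iff f (j + 2) rfl hf j rfl]
  exact hz f hf

lemma subsingleton_ext_of_iso {X X' Y : ModuleCat.{u} R} (e : X ≅ X') {j : ℕ}
    (h : Subsingleton (Abelian.Ext.{u} X Y j)) : Subsingleton (Abelian.Ext.{u} X' Y j) := by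
  refine subsingleton_of_forall_eq 0 fun x ↦ ?_
  rw [← Ext.mk₀_id_comp x, ← e.inv_hom_id, ← Ext.mk₀_comp_mk₀_assoc,
    Subsingleton.elim ((Ext.mk₀ e.hom).comp x (zero_add j)) 0, Ext.comp_zero]

variable {M N : ModuleCat.{u} R} (f : M →ₗ[R] N)

lemma shortExact_ker_range :
    (ShortComplex.mk (ModuleCat.ofHom (LinearMap.ker f).subtype)
      (ModuleCat.ofHom f.rangeRestrict) (by ext x; exact x.2)).ShortExact where
  exact := by
    rw [ShortComplex.moduleCat_exact_iff]
    intro x hx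
    exact ⟨⟨x, congrArg Subtype.val hx⟩, rfl⟩
  mono_f := (ModuleCat.mono_iff_injective _).2 Subtype.val_injective
  epi_g := (ModuleCat.epi_iff_surjective _).2 f.surjective_rangeRestrict

lemma subsingleton_ext_ker {Y : ModuleCat.{u} R} {j : ℕ}
    (hM : Subsingleton (Abelian.Ext.{u} M Y j))
    (hf : Subsingleton (Abelian.Ext.{u} (ModuleCat.of R (LinearMap.range f)) Y (j + 1))) :
    Subsingleton (Abelian.Ext.{u} (ModuleCat.of R (LinearMap.ker f)) Y j) := by
  refine subsingleton_of_forall_eq 0 fun x ↦ ?_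
  obtain ⟨y, rfl⟩ := Ext.contravariant_sequence_exact₁ (shortExact_ker_range f) Y x
    (add_comm 1 j) (hf.elim _ _)
  rw [hM.elim y 0, Ext.comp_zero]

lemma exists_extend_ker {Y : ModuleCat.{u} R}
    (hf : Subsingleton (Abelian.Ext.{u} (ModuleCat.of R (LinearMap.range f)) Y 1))
    (φ : LinearMap.ker f →ₗ[R] Y) : ∃ ψ : M →ₗ[R] Y, ψ ∘ₗ (LinearMap.ker f).subtype = φ := by
  obtain ⟨y, hy⟩ := Ext.contravariant_sequence_exact₁ (shortExact_ker_range f) Y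
    (Ext.mk₀ (ModuleCat.ofHom φ)) (add_zero 1) (hf.elim _ _)
  obtain ⟨ψ, rfl⟩ := (Ext.mk₀_bijective _ _).2 y
  rw [Ext.mk₀_comp_mk₀] at hy
  exact ⟨ψ.hom, congrArg ModuleCat.Hom.hom ((Ext.mk₀_bijective _ _).1 hy)⟩

end AB

end ExtVanishing

theorem dual_sequence_exact (R : Type u) [CommRing R] (n : ℕ)
    (B : Fin (n + 2) → ModuleCat.{u} R)
    (e : ∀ i : Fin (n + 1), (B i.castSucc →ₗ[R] B i.succ))
    (hinj : Function.Injective (e 0))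
    (hsurj : Function.Surjective (e (Fin.last n)))
    (hex : ∀ i : Fin n, LinearMap.range (e i.castSucc) = LinearMap.ker (e i.succ))
    (hext : ∀ (i j : ℕ) (hi1 : 1 ≤ i) (hi2 : i ≤ n) (hj1 : 1 ≤ j) (hj2 : j ≤ i),
      AB.extZero R (B ⟨i + 1, by omega⟩) (ModuleCat.of R R) j) :
    Function.Injective ((e (Fin.last n)).dualMap) ∧
    Function.Surjective ((e 0).dualMap) ∧
    ∀ i : Fin n, LinearMap.range ((e i.succ).dualMap) =
      LinearMap.ker ((e i.castSucc).dualMap) := by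
  have hK : ∀ i : Fin (n + 1), ∀ j, j + 1 ≤ (i : ℕ) → Subsingleton (Abelian.Ext.{u}
      (ModuleCat.of R (LinearMap.range (e i))) (ModuleCat.of R R) (j + 1)) := by
    have hB (i : Fin (n + 1)) (j : ℕ) (hj : j + 1 ≤ (i : ℕ)) :
        Subsingleton (Abelian.Ext.{u} (B i.succ) (ModuleCat.of R R) (j + 1)) :=
      (hext i (j + 1) (by omega) (by omega) (by omega) hj).subsingleton_abelianExt
    intro i
    induction i using Fin.reverseInduction with
    | last =>
      intro j hj
      exact AB.subsingleton_ext_of_iso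
        (LinearEquiv.ofTop _ (LinearMap.range_eq_top.2 hsurj)).symm.toModuleIso (hB _ j hj)
    | cast i ih =>
      intro j hj
      rw [hex i]
      exact AB.subsingleton_ext_ker (e i.succ) (hB i.castSucc j hj)
        (ih (j + 1) (by simpa using hj))
  have hextend : ∀ (i : Fin (n + 1)) (φ : LinearMap.range (e i) →ₗ[R] R),
      ∃ ψ : B i.succ →ₗ[R] R, ψ ∘ₗ (LinearMap.range (e i)).subtype = φ := by
    intro i
    induction i using Fin.lastCases with
    | last =>
      intro φ
      exact ⟨φ ∘ₗ (LinearEquiv.ofTop _ (LinearMap.range_eq_top.2 hsurj)).symm.toLinearMap, rfl⟩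
    | cast i =>
      rw [hex i]
      exact AB.exists_extend_ker (Y := ModuleCat.of R R) (e i.succ) (hK i.succ 0 (by simp))
  refine ⟨LinearMap.dualMap_injective_of_surjective hsurj, fun φ ↦ ?_, fun i ↦ le_antisymm ?_ ?_⟩
  · obtain ⟨ψ, hψ⟩ := hextend 0 (φ ∘ₗ (LinearEquiv.ofInjective (e 0) hinj).symm.toLinearMap)
    refine ⟨ψ, LinearMap.ext fun x ↦ ?_⟩
    exact (LinearMap.congr_fun hψ (LinearEquiv.ofInjective (e 0) hinj x)).trans
      (congrArg φ ((LinearEquiv.ofInjective (e 0) hinj).symm_apply_apply x))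
  · rintro _ ⟨φ, rfl⟩
    refine LinearMap.ext fun x ↦ ?_
    have hx : e i.castSucc x ∈ LinearMap.ker (e i.succ) := hex i ▸ LinearMap.mem_range_self _ x
    exact (congrArg φ hx).trans φ.map_zero
  · intro φ hφ
    have hker : LinearMap.ker (e i.succ) ≤ LinearMap.ker φ := by
      rw [← hex i]
      rintro _ ⟨x, rfl⟩
      exact LinearMap.congr_fun hφ x
    obtain ⟨ψ, hψ⟩ := hextend i.succ
      ((LinearMap.ker (e i.succ)).liftQ φ hker ∘ₗ (e i.succ).quotKerEquivRange.symm.toLinearMap)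
    refine ⟨ψ, LinearMap.ext fun x ↦ ?_⟩
    have := LinearMap.congr_fun hψ ((e i.succ).quotKerEquivRange (Submodule.Quotient.mk x))
    simpa using this
end

section
/- Let R be a commutative ring, M a nonzero R-module with G̃dim_R M < ∞, and x a non-zero-divisor on R with xM = 0. Then G̃dim_{R/(x)} M = G̃dim_R M − 1. -/
open CategoryTheory Opposite TensorProduct

universe u

namespace AB

/-- The sequence `0 → A → B → C → 0` given by `f` and `g` is exact. -/
structure IsSES {R A B C : Type*} [CommRing R] [AddCommGroup A] [Module R A] [AddCommGroup B]
    [Module R B] [AddCommGroup C] [Module R C] (f : A →ₗ[R] B) (g : B →ₗ[R] C) : Prop where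
  inj : Function.Injective f
  exact : Function.Exact f g
  surj : Function.Surjective g

namespace IsSES

variable {R A B C P : Type*} [CommRing R] [AddCommGroup A] [Module R A] [AddCommGroup B]
  [Module R B] [AddCommGroup C] [Module R C] [AddCommGroup P] [Module R P]
  {f : A →ₗ[R] B} {g : B →ₗ[R] C}

lemma apply_apply (h : IsSES f g) (a : A) : g (f a) = 0 := h.exact.apply_apply_eq_zero a

lemma exists_of_apply_eq_zero (h : IsSES f g) {b : B} (hb : g b = 0) : ∃ a, f a = b :=
  (h.exact b).1 hb

lemma exists_factor (h : IsSES f g) (φ : P →ₗ[R] B) (hφ : ∀ p, g (φ p) = 0) :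
    ∃ ψ : P →ₗ[R] A, ∀ p, f (ψ p) = φ p := by
  let e := LinearEquiv.ofInjective f h.inj
  have H (p : P) : φ p ∈ LinearMap.range f := h.exists_of_apply_eq_zero (hφ p)
  refine ⟨e.symm.toLinearMap ∘ₗ φ.codRestrict _ H, fun p => ?_⟩
  exact congrArg Subtype.val (e.apply_symm_apply ⟨φ p, H p⟩)

lemma exists_descend (h : IsSES f g) (φ : B →ₗ[R] P) (hφ : ∀ a, φ (f a) = 0) :
    ∃ ψ : C →ₗ[R] P, ∀ b, ψ (g b) = φ b := by
  have H : LinearMap.ker g ≤ LinearMap.ker φ := by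
    intro b hb
    obtain ⟨a, rfl⟩ := h.exists_of_apply_eq_zero hb
    exact hφ a
  refine ⟨(LinearMap.ker g).liftQ φ H ∘ₗ (g.quotKerEquivOfSurjective h.surj).symm.toLinearMap,
    fun b => ?_⟩
  have : (g.quotKerEquivOfSurjective h.surj).symm (g b) = Submodule.Quotient.mk b := by
    rw [LinearEquiv.symm_apply_eq]; rfl
  simp [this]

lemma of_ker {g : B →ₗ[R] C} (hg : Function.Surjective g) :
    IsSES (LinearMap.ker g).subtype g :=
  ⟨Subtype.val_injective, LinearMap.exact_subtype_ker_map g, hg⟩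

lemma prod : IsSES (LinearMap.inl R A B) (LinearMap.snd R A B) :=
  ⟨LinearMap.inl_injective, .inl_snd, LinearMap.snd_surjective⟩

lemma prod_symm : IsSES (LinearMap.inr R A B) (LinearMap.fst R A B) :=
  ⟨LinearMap.inr_injective, .inr_fst, LinearMap.fst_surjective⟩

lemma restrictScalars {R₀ : Type*} [CommRing R₀] [Algebra R₀ R] [Module R₀ A] [Module R₀ B]
    [Module R₀ C] [IsScalarTower R₀ R A] [IsScalarTower R₀ R B] [IsScalarTower R₀ R C]
    (h : IsSES f g) : IsSES (f.restrictScalars R₀) (g.restrictScalars R₀) :=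
  ⟨h.inj, h.exact, h.surj⟩

/-- The kernels of a surjection `p` and of its composition with `g`, where `A` is the kernel
of `g`. -/
lemma exists_ker_comp (h : IsSES f g) (p : P →ₗ[R] B) (hp : Function.Surjective p) :
    ∃ (i : LinearMap.ker p →ₗ[R] LinearMap.ker (g ∘ₗ p)) (j : LinearMap.ker (g ∘ₗ p) →ₗ[R] A),
      IsSES i j := by
  obtain ⟨j, hj⟩ := h.exists_factor (p ∘ₗ (LinearMap.ker (g ∘ₗ p)).subtype) fun k => k.2
  refine ⟨Submodule.inclusion fun v hv => by
    rw [LinearMap.mem_ker] at hv; simp [hv], j, Submodule.inclusion_injective _, ?_, ?_⟩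
  · intro v
    rw [← h.inj.eq_iff, hj, map_zero]
    exact ⟨fun hv => ⟨⟨v, hv⟩, rfl⟩, by rintro ⟨w, rfl⟩; exact w.2⟩
  · intro a
    obtain ⟨v, hv⟩ := hp (f a)
    refine ⟨⟨v, by simp [hv, h.apply_apply]⟩, h.inj ?_⟩
    rw [hj]
    exact hv

lemma coprod_surjective {G F : Type*} [AddCommGroup G] [Module R G] [AddCommGroup F] [Module R F]
    (h : IsSES f g) (p : G →ₗ[R] A) (hp : Function.Surjective p) (q : F →ₗ[R] B)
    (hq : Function.Surjective (g ∘ₗ q)) : Function.Surjective ((f ∘ₗ p).coprod q) := by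
  intro b
  obtain ⟨v, hv⟩ := hq (g b)
  obtain ⟨a, ha⟩ := h.exists_of_apply_eq_zero (b := b - q v) (by
    rw [map_sub, sub_eq_zero]; exact hv.symm)
  obtain ⟨w, rfl⟩ := hp a
  exact ⟨(w, v), by simp [ha]⟩

/-- The sequence of kernels in the horseshoe lemma. -/
lemma exists_horseshoe {G F : Type*} [AddCommGroup G] [Module R G] [AddCommGroup F] [Module R F]
    (h : IsSES f g) (p : G →ₗ[R] A) (hp : Function.Surjective p) (q : F →ₗ[R] B) :
    ∃ (i : LinearMap.ker p →ₗ[R] LinearMap.ker ((f ∘ₗ p).coprod q))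
      (j : LinearMap.ker ((f ∘ₗ p).coprod q) →ₗ[R] LinearMap.ker (g ∘ₗ q)), IsSES i j := by
  refine ⟨(LinearMap.inl R G F ∘ₗ (LinearMap.ker p).subtype).codRestrict _ fun v => ?_,
    (LinearMap.snd R G F ∘ₗ Submodule.subtype _).codRestrict _ fun v => ?_, ?_, ?_, ?_⟩
  · have := v.2
    rw [LinearMap.mem_ker] at this
    simp [this]
  · obtain ⟨⟨a, b⟩, hv⟩ := v
    have := congrArg g hv
    simpa [h.apply_apply] using this
  · intro v w hvw
    have := congrArg (fun z => z.1.1) hvw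
    exact Subtype.ext this
  · rintro ⟨⟨a, b⟩, hv⟩
    constructor
    · intro hb
      obtain rfl : b = 0 := congrArg Subtype.val hb
      have hv' : f (p a) = 0 := by simpa using hv
      exact ⟨⟨a, h.inj (by rw [hv', map_zero])⟩, rfl⟩
    · rintro ⟨w, hw⟩
      have := congrArg (fun z => z.1.2) hw
      exact Subtype.ext this.symm
  · rintro ⟨b, hb⟩
    obtain ⟨a, ha⟩ := h.exists_of_apply_eq_zero hb
    obtain ⟨c, rfl⟩ := hp a
    exact ⟨⟨(-c, b), by simp [ha]⟩, rfl⟩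

end IsSES

section Ext

variable {R : Type u} [CommRing R]

/-- Vanishing of `Ext^i_R(M, N)`, in terms of the derived category. -/
def ExtVanish (R : Type u) [CommRing R] (M N : Type u) [AddCommGroup M] [Module R M]
    [AddCommGroup N] [Module R N] (i : ℕ) : Prop :=
  Subsingleton (Abelian.Ext (ModuleCat.of R M) (ModuleCat.of R N) i)

lemma extZero_iff_extVanish (M N : ModuleCat.{u} R) (n : ℕ) :
    extZero R M N (n + 1) ↔ ExtVanish R M N (n + 1) := by
  let P := projectiveResolution M
  have h₁ : extZero R M N (n + 1) ↔ ∀ f : P.complex.X (n + 1) ⟶ N,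
      P.complex.d (n + 2) (n + 1) ≫ f = 0 → ∃ g : P.complex.X n ⟶ N,
        P.complex.d (n + 1) n ≫ g = f := by
    have e := P.isoExt (R := R) (n + 1) N
    rw [extZero, ← ModuleCat.isZero_iff_subsingleton, e.isZero_iff,
      ← HomologicalComplex.exactAt_iff_isZero_homology,
      HomologicalComplex.exactAt_iff' _ n (n + 1) (n + 2) (by simp) (by simp),
      ShortComplex.moduleCat_exact_iff]
    rfl
  rw [h₁]
  constructor
  · intro h
    refine ⟨fun a b => ?_⟩
    suffices ∀ a : Abelian.Ext M N (n + 1), a = 0 from (this a).trans (this b).symm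
    intro a
    obtain ⟨f, hf, rfl⟩ := P.extMk_surjective a (n + 2) rfl
    rw [P.extMk_eq_zero_iff f _ rfl hf n rfl]
    exact h f hf
  · intro h f hf
    rw [← P.extMk_eq_zero_iff f (n + 2) rfl hf n rfl]
    exact h.elim _ _

variable {A B C N : Type u} [AddCommGroup A] [Module R A] [AddCommGroup B] [Module R B]
  [AddCommGroup C] [Module R C] [AddCommGroup N] [Module R N]

lemma extVanish_of_projective (i : ℕ) [Module.Projective R A] : ExtVanish R A N (i + 1) := by
  have : Projective (ModuleCat.of R A) := (IsProjective.iff_projective A).1 inferInstance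
  exact ⟨fun a b => (Abelian.Ext.eq_zero_of_projective a).trans
    (Abelian.Ext.eq_zero_of_projective b).symm⟩

lemma extVanish_iff {i : ℕ} : ExtVanish R A N i ↔
    ∀ a : Abelian.Ext (ModuleCat.of R A) (ModuleCat.of R N) i, a = 0 :=
  ⟨fun h _ => h.elim _ _, fun h => ⟨fun a b => (h a).trans (h b).symm⟩⟩

variable {f : A →ₗ[R] B} {g : B →ₗ[R] C}

/-- The short complex of modules attached to two composable maps with zero composition. -/
abbrev sc (h : Function.Exact f g) : ShortComplex (ModuleCat.{u} R) :=
  ShortComplex.mk (ModuleCat.ofHom f) (ModuleCat.ofHom g)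
    (by ext x; exact h.apply_apply_eq_zero x)

lemma IsSES.shortExact (h : IsSES f g) : (sc h.exact).ShortExact :=
  ModuleCat.shortComplex_shortExact (sc h.exact) h.exact h.inj h.surj

lemma ExtVanish.mid (h : IsSES f g) {i : ℕ} (hA : ExtVanish R A N i) (hC : ExtVanish R C N i) :
    ExtVanish R B N i := by
  rw [extVanish_iff] at *
  intro b
  obtain ⟨c, rfl⟩ := Abelian.Ext.contravariant_sequence_exact₂ h.shortExact _ b (hA _)
  rw [hC c, Abelian.Ext.comp_zero]

lemma ExtVanish.left (h : IsSES f g) {i : ℕ} (hB : ExtVanish R B N i)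
    (hC : ExtVanish R C N (i + 1)) : ExtVanish R A N i := by
  rw [extVanish_iff] at *
  intro a
  obtain ⟨b, rfl⟩ := Abelian.Ext.contravariant_sequence_exact₁ h.shortExact _ a
    (add_comm _ _) (hC _)
  rw [hB b, Abelian.Ext.comp_zero]

lemma ExtVanish.right (h : IsSES f g) {i : ℕ} (hA : ExtVanish R A N i)
    (hB : ExtVanish R B N (i + 1)) : ExtVanish R C N (i + 1) := by
  rw [extVanish_iff] at *
  intro c
  obtain ⟨a, rfl⟩ := Abelian.Ext.contravariant_sequence_exact₃ h.shortExact _ c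
    (hB _) (add_comm _ _)
  rw [hA a, Abelian.Ext.comp_zero]

lemma ExtVanish.extend (h : IsSES f g) (hC : ExtVanish R C N 1) (φ : A →ₗ[R] N) :
    ∃ ψ : B →ₗ[R] N, ∀ a, ψ (f a) = φ a := by
  rw [extVanish_iff] at hC
  obtain ⟨b, hb⟩ := Abelian.Ext.contravariant_sequence_exact₁ h.shortExact _
    (Abelian.Ext.mk₀ (ModuleCat.ofHom φ)) (add_comm _ _) (hC _)
  obtain ⟨ψ, rfl⟩ := (Abelian.Ext.mk₀_bijective _ _).2 b
  rw [Abelian.Ext.mk₀_comp_mk₀] at hb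
  have := (Abelian.Ext.mk₀_bijective _ _).1 hb
  exact ⟨ψ.hom, fun a => congrArg (fun t => t.hom a) this⟩

lemma ExtVanish.one_of_extend (h : IsSES f g) (hB : ExtVanish R B N 1)
    (H : ∀ φ : A →ₗ[R] N, ∃ ψ : B →ₗ[R] N, ∀ a, ψ (f a) = φ a) : ExtVanish R C N 1 := by
  rw [extVanish_iff] at *
  intro c
  obtain ⟨a, rfl⟩ := Abelian.Ext.contravariant_sequence_exact₃ h.shortExact _ c
    (hB _) (add_comm _ _)
  obtain ⟨φ, rfl⟩ := (Abelian.Ext.mk₀_bijective _ _).2 a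
  obtain ⟨ψ, hψ⟩ := H φ.hom
  have : φ = (sc h.exact).f ≫ ModuleCat.ofHom ψ := by
    ext x; exact (hψ x).symm
  rw [this, ← Abelian.Ext.mk₀_comp_mk₀, h.shortExact.extClass_comp_assoc]

lemma ExtVanish.lift (h : IsSES f g) (hN : ExtVanish R N A 1) (φ : N →ₗ[R] C) :
    ∃ ψ : N →ₗ[R] B, ∀ n, g (ψ n) = φ n := by
  rw [extVanish_iff] at hN
  obtain ⟨b, hb⟩ := Abelian.Ext.covariant_sequence_exact₃ _ h.shortExact
    (Abelian.Ext.mk₀ (ModuleCat.ofHom φ)) (zero_add _) (hN _)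
  obtain ⟨ψ, rfl⟩ := (Abelian.Ext.mk₀_bijective _ _).2 b
  rw [Abelian.Ext.mk₀_comp_mk₀] at hb
  have := (Abelian.Ext.mk₀_bijective _ _).1 hb
  exact ⟨ψ.hom, fun a => congrArg (fun t => t.hom a) this⟩

end Ext

section FP

variable {R : Type u} [CommRing R]
variable {A B C : Type u} [AddCommGroup A] [Module R A] [AddCommGroup B] [Module R B]
  [AddCommGroup C] [Module R C] {f : A →ₗ[R] B} {g : B →ₗ[R] C}

lemma IsFP.of_equiv (e : A ≃ₗ[R] B) {n : ℕ} (h : IsFP R n (ModuleCat.of R A)) :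
    IsFP R n (ModuleCat.of R B) := by
  cases n with
  | zero => exact @Module.Finite.equiv _ _ _ _ _ _ _ _ h e
  | succ n =>
    obtain ⟨k, p, hp, hk⟩ := h
    refine ⟨k, (e : A →ₗ[R] B) ∘ₗ p, e.surjective.comp hp, ?_⟩
    rw [LinearEquiv.ker_comp]
    exact hk

lemma isFP_of_subsingleton [Subsingleton A] (n : ℕ) : IsFP R n (ModuleCat.of R A) := by
  induction n generalizing A with
  | zero => exact (inferInstance : Module.Finite R A)
  | succ n ih => exact ⟨0, 0, fun _ => ⟨0, Subsingleton.elim (α := A) _ _⟩, ih⟩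

lemma isFP_succ_of_surjective {F : Type u} [AddCommGroup F] [Module R F] [Module.Finite R F]
    [Module.Free R F] {n : ℕ} (p : F →ₗ[R] A) (hp : Function.Surjective p)
    (h : IsFP R n (ModuleCat.of R (LinearMap.ker p))) : IsFP R (n + 1) (ModuleCat.of R A) := by
  let b := (Module.Free.chooseBasis R F).reindex (Fintype.equivFin _)
  refine ⟨_, p ∘ₗ b.equivFun.symm.toLinearMap, hp.comp b.equivFun.symm.surjective, ?_⟩
  rw [LinearMap.ker_comp]
  exact h.of_equiv (b.equivFun.symm.ofSubmodule' (LinearMap.ker p)).symm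

lemma isFP_of_free [Module.Finite R A] [Module.Free R A] (n : ℕ) :
    IsFP R n (ModuleCat.of R A) := by
  cases n with
  | zero => exact (inferInstance : Module.Finite R A)
  | succ n =>
    refine isFP_succ_of_surjective LinearMap.id Function.surjective_id ?_
    rw [LinearMap.ker_id]
    exact isFP_of_subsingleton n

lemma IsFP.mid (h : IsSES f g) {n : ℕ} (hA : IsFP R n (ModuleCat.of R A))
    (hC : IsFP R n (ModuleCat.of R C)) : IsFP R n (ModuleCat.of R B) := by
  induction n generalizing A B C with
  | zero =>
    have : Module.Finite R A := hA
    have : Module.Finite R C := hC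
    exact Module.Finite.of_exact h.exact h.surj
  | succ n ih =>
    obtain ⟨k, p, hp, hk⟩ := hA
    obtain ⟨l, q, hq, hl⟩ := hC
    obtain ⟨q, rfl⟩ := Module.projective_lifting_property g q h.surj
    obtain ⟨i, j, hij⟩ := h.exists_horseshoe p hp q
    exact isFP_succ_of_surjective _ (h.coprod_surjective p hp q hq) (ih hij hk hl)

lemma IsFP.right (h : IsSES f g) {n : ℕ} (hA : IsFP R n (ModuleCat.of R A))
    (hB : IsFP R (n + 1) (ModuleCat.of R B)) : IsFP R (n + 1) (ModuleCat.of R C) := by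
  obtain ⟨k, p, hp, hk⟩ := hB
  obtain ⟨i, j, hij⟩ := h.exists_ker_comp p hp
  exact ⟨k, g ∘ₗ p, h.surj.comp hp, hk.mid hij hA⟩

lemma IsFP.left (h : IsSES f g) {n : ℕ} (hB : IsFP R n (ModuleCat.of R B))
    (hC : IsFP R (n + 1) (ModuleCat.of R C)) : IsFP R n (ModuleCat.of R A) := by
  obtain ⟨l, q, hq, hl⟩ := hC
  obtain ⟨q, rfl⟩ := Module.projective_lifting_property g q h.surj
  have hid := Function.surjective_id (α := A)
  obtain ⟨i, j, hij⟩ := h.exists_horseshoe LinearMap.id hid q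
  have h₀ : IsFP R n (ModuleCat.of R (LinearMap.ker (LinearMap.id : A →ₗ[R] A))) := by
    rw [LinearMap.ker_id]
    exact isFP_of_subsingleton n
  have h₁ := (h₀.mid hij hl).mid (.of_ker (h.coprod_surjective LinearMap.id hid q hq)) hB
  cases n with
  | zero =>
    have : Module.Finite R (A × (Fin l → R)) := h₁
    exact Module.Finite.of_surjective (LinearMap.fst R A (Fin l → R)) LinearMap.fst_surjective
  | succ n => exact (isFP_of_free n).right .prod_symm h₁

lemma IsFPInf.mid (h : IsSES f g) (hA : IsFPInf R (ModuleCat.of R A))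
    (hC : IsFPInf R (ModuleCat.of R C)) : IsFPInf R (ModuleCat.of R B) :=
  fun n => (hA n).mid h (hC n)

lemma IsFPInf.left (h : IsSES f g) (hB : IsFPInf R (ModuleCat.of R B))
    (hC : IsFPInf R (ModuleCat.of R C)) : IsFPInf R (ModuleCat.of R A) :=
  fun n => (hB n).left h (hC (n + 1))

lemma IsFPInf.right (h : IsSES f g) (hA : IsFPInf R (ModuleCat.of R A))
    (hB : IsFPInf R (ModuleCat.of R B)) : IsFPInf R (ModuleCat.of R C)
  | 0 =>
    have : Module.Finite R B := hB 0
    Module.Finite.of_surjective g h.surj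
  | n + 1 => (hA n).right h (hB (n + 1))

end FP

section Gtilde

variable {R : Type u} [CommRing R]
variable {A B C : Type u} [AddCommGroup A] [Module R A] [AddCommGroup B] [Module R B]
  [AddCommGroup C] [Module R C] {f : A →ₗ[R] B} {g : B →ₗ[R] C}

open Module

/-- Membership in the restricted G-class, for unbundled modules. -/
structure IsGtilde (R : Type u) [CommRing R] (M : Type u) [AddCommGroup M] [Module R M] :
    Prop where
  refl : IsReflexive R M
  fp : IsFPInf R (ModuleCat.of R M)
  fp_dual : IsFPInf R (ModuleCat.of R (Dual R M))
  ext : ∀ i, ExtVanish R M R (i + 1)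
  ext_dual : ∀ i, ExtVanish R (Dual R M) R (i + 1)

lemma memGtilde_iff : MemGtilde R (ModuleCat.of R A) ↔ IsGtilde R A := by
  have key (M : ModuleCat.{u} R) : (∀ i > 0, extZero R M (ModuleCat.of R R) i) ↔
      ∀ i, ExtVanish R M R (i + 1) := by
    constructor
    · exact fun h i => (extZero_iff_extVanish M _ i).1 (h _ i.succ_pos)
    · rintro h (_ | i) hi
      · exact absurd hi (lt_irrefl 0)
      · exact (extZero_iff_extVanish M _ i).2 (h i)
  constructor
  · rintro ⟨⟨_, h, h₁, h₂⟩, h₃, h₄⟩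
    exact ⟨h, h₃, h₄, (key _).1 h₁, (key _).1 h₂⟩
  · rintro ⟨h, h₃, h₄, h₁, h₂⟩
    exact ⟨⟨h₃ 0, h, (key _).2 h₁, (key _).2 h₂⟩, h₃, h₄⟩

lemma isGtilde_of_free [Module.Finite R A] [Module.Free R A] : IsGtilde R A where
  refl := inferInstance
  fp := isFP_of_free
  fp_dual := isFP_of_free
  ext _ := extVanish_of_projective _
  ext_dual _ := extVanish_of_projective _

lemma exists_eval [IsReflexive R A] (φ : Dual R A →ₗ[R] R) :
    ∃ a : A, ∀ ψ : Dual R A, φ ψ = ψ a := by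
  obtain ⟨a, rfl⟩ := (bijective_dual_eval R A).2 φ
  exact ⟨a, fun _ => rfl⟩

lemma eq_zero_of_dual [IsReflexive R A] {a : A} (h : ∀ ψ : Dual R A, ψ a = 0) : a = 0 :=
  (bijective_dual_eval R A).1 (by rw [map_zero]; exact LinearMap.ext h)

lemma isReflexive_of_forall (h₁ : ∀ a : A, (∀ ψ : Dual R A, ψ a = 0) → a = 0)
    (h₂ : ∀ φ : Dual R A →ₗ[R] R, ∃ a : A, ∀ ψ : Dual R A, φ ψ = ψ a) : IsReflexive R A where
  bijective_dual_eval' := by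
    constructor
    · rw [injective_iff_map_eq_zero]
      exact fun a ha => h₁ a fun ψ => LinearMap.congr_fun ha ψ
    · intro φ
      obtain ⟨a, ha⟩ := h₂ φ
      exact ⟨a, LinearMap.ext fun ψ => (ha ψ).symm⟩

lemma IsSES.dual (h : IsSES f g) (hC : ExtVanish R C R 1) : IsSES g.dualMap f.dualMap where
  inj := LinearMap.dualMap_injective_of_surjective h.surj
  exact φ := by
    constructor
    · intro hφ
      obtain ⟨ψ, hψ⟩ := h.exists_descend φ fun a => LinearMap.congr_fun hφ a
      exact ⟨ψ, LinearMap.ext hψ⟩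
    · rintro ⟨ψ, rfl⟩
      ext a
      simp [h.apply_apply]
  surj φ := by
    obtain ⟨ψ, hψ⟩ := hC.extend h φ
    exact ⟨ψ, LinearMap.ext hψ⟩

lemma IsGtilde.mid (h : IsSES f g) (hA : IsGtilde R A) (hC : IsGtilde R C) : IsGtilde R B := by
  have hd := h.dual (hC.ext 0)
  refine ⟨?_, hA.fp.mid h hC.fp, hC.fp_dual.mid hd hA.fp_dual,
    fun i => (hA.ext i).mid h (hC.ext i), fun i => (hC.ext_dual i).mid hd (hA.ext_dual i)⟩
  have := hA.refl
  have := hC.refl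
  refine isReflexive_of_forall (fun b hb => ?_) fun φ => ?_
  · obtain ⟨a, rfl⟩ := h.exists_of_apply_eq_zero
      (eq_zero_of_dual (a := g b) fun ψ => hb (g.dualMap ψ))
    rw [eq_zero_of_dual (R := R) (a := a) fun ψ => ?_, map_zero]
    obtain ⟨ψ, rfl⟩ := hd.surj ψ
    exact hb ψ
  · obtain ⟨c, hc⟩ := exists_eval (φ ∘ₗ g.dualMap)
    obtain ⟨b, rfl⟩ := h.surj c
    obtain ⟨θ, hθ⟩ := hd.exists_descend (φ - Dual.eval R B b) fun ψ => by
      simpa [sub_eq_zero] using hc ψ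
    obtain ⟨a, ha⟩ := exists_eval θ
    refine ⟨b + f a, fun ψ => ?_⟩
    have h₁ := hθ ψ
    rw [ha] at h₁
    simp only [LinearMap.dualMap_apply, LinearMap.sub_apply, Dual.eval_apply] at h₁
    rw [map_add, h₁, add_sub_cancel]

lemma IsGtilde.left (h : IsSES f g) (hB : IsGtilde R B) (hC : IsGtilde R C) : IsGtilde R A := by
  have hd := h.dual (hC.ext 0)
  have := hB.refl
  have := hC.refl
  refine ⟨isReflexive_of_forall (fun a ha => h.inj ?_) fun φ => ?_, hB.fp.left h hC.fp,
    hC.fp_dual.right hd hB.fp_dual, fun i => (hB.ext i).left h (hC.ext (i + 1)), ?_⟩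
  · rw [map_zero]
    exact eq_zero_of_dual fun ψ => ha (f.dualMap ψ)
  · obtain ⟨b, hb⟩ := exists_eval (φ ∘ₗ f.dualMap)
    have hgb : g b = 0 := eq_zero_of_dual fun ψ => by
      rw [← LinearMap.dualMap_apply, ← hb]
      simp [hd.apply_apply]
    obtain ⟨a, rfl⟩ := h.exists_of_apply_eq_zero hgb
    refine ⟨a, fun ψ => ?_⟩
    obtain ⟨ψ, rfl⟩ := hd.surj ψ
    exact hb ψ
  · rintro (_ | i)
    · refine .one_of_extend hd (hB.ext_dual 0) fun φ => ?_
      obtain ⟨c, hc⟩ := exists_eval φ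
      obtain ⟨b, rfl⟩ := h.surj c
      exact ⟨Dual.eval R B b, fun ψ => (hc ψ).symm⟩
    · exact (hC.ext_dual i).right hd (hB.ext_dual (i + 1))

lemma IsGtilde.right (h : IsSES f g) (hA : IsGtilde R A) (hB : IsGtilde R B)
    (hC : ∀ i, ExtVanish R C R (i + 1)) : IsGtilde R C := by
  have hd := h.dual (hC 0)
  have := hA.refl
  have := hB.refl
  refine ⟨isReflexive_of_forall (fun c hc => ?_) fun φ => ?_, hA.fp.right h hB.fp,
    hB.fp_dual.left hd hA.fp_dual, hC,
    fun i => (hB.ext_dual i).left hd (hA.ext_dual (i + 1))⟩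
  · obtain ⟨b, rfl⟩ := h.surj c
    obtain ⟨θ, hθ⟩ := hd.exists_descend (Dual.eval R B b) hc
    obtain ⟨a, ha⟩ := exists_eval θ
    have : b - f a = 0 := eq_zero_of_dual fun ψ => by
      have := (ha (f.dualMap ψ)).symm.trans (hθ ψ)
      rw [map_sub, sub_eq_zero]
      exact this.symm
    rw [sub_eq_zero.1 this, h.apply_apply]
  · obtain ⟨Φ, hΦ⟩ := (hA.ext_dual 0).extend hd φ
    obtain ⟨b, hb⟩ := exists_eval Φ
    exact ⟨g b, fun ψ => (hΦ ψ).symm.trans (hb _)⟩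

end Gtilde

section Dimension

variable {R : Type u} [CommRing R]
variable {A B C : Type u} [AddCommGroup A] [Module R A] [AddCommGroup B] [Module R B]
  [AddCommGroup C] [Module R C] {f : A →ₗ[R] B} {g : B →ₗ[R] C}

lemma gtildeDimLe_zero_iff : GtildeDimLe R 0 (ModuleCat.of R A) ↔ IsGtilde R A := memGtilde_iff

lemma gtildeDimLe_succ {n : ℕ} (g : B →ₗ[R] C) (hg : Function.Surjective g) (hB : IsGtilde R B)
    (h : GtildeDimLe R n (ModuleCat.of R (LinearMap.ker g))) :
    GtildeDimLe R (n + 1) (ModuleCat.of R C) :=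
  ⟨ModuleCat.of R B, g, memGtilde_iff.2 hB, hg, h⟩

lemma GtildeDimLe.exists {n : ℕ} (h : GtildeDimLe R (n + 1) (ModuleCat.of R C)) :
    ∃ (B : Type u) (_ : AddCommGroup B) (_ : Module R B) (g : B →ₗ[R] C), IsGtilde R B ∧
      Function.Surjective g ∧ GtildeDimLe R n (ModuleCat.of R (LinearMap.ker g)) := by
  obtain ⟨G, g, hG, hg, hk⟩ := h
  exact ⟨G, _, _, g, memGtilde_iff.1 hG, hg, hk⟩

lemma GtildeDimLe.mid (h : IsSES f g) {n : ℕ} (hA : GtildeDimLe R n (ModuleCat.of R A))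
    (hC : IsGtilde R C) : GtildeDimLe R n (ModuleCat.of R B) := by
  induction n generalizing A B C with
  | zero => exact gtildeDimLe_zero_iff.2 ((gtildeDimLe_zero_iff.1 hA).mid h hC)
  | succ n ih =>
    obtain ⟨G, _, _, p, hG, hp, hk⟩ := hA.exists
    have : Module.Finite R C := hC.fp 0
    obtain ⟨l, q, hq⟩ := Module.Finite.exists_fin' R C
    obtain ⟨q, rfl⟩ := Module.projective_lifting_property g q h.surj
    obtain ⟨i, j, hij⟩ := h.exists_horseshoe p hp q
    exact gtildeDimLe_succ _ (h.coprod_surjective p hp q hq) (hG.mid .prod isGtilde_of_free)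
      (ih hij hk (isGtilde_of_free.left (.of_ker hq) hC))

lemma GtildeDimLe.extVanish {n : ℕ} (h : GtildeDimLe R n (ModuleCat.of R A)) {i : ℕ}
    (hi : n ≤ i) : ExtVanish R A R (i + 1) := by
  induction n generalizing A i with
  | zero => exact (gtildeDimLe_zero_iff.1 h).ext i
  | succ n ih =>
    obtain ⟨G, _, _, p, hG, hp, hk⟩ := h.exists
    obtain ⟨i, rfl⟩ := Nat.exists_eq_succ_of_ne_zero (by omega : i ≠ 0)
    exact (ih hk (by omega)).right (.of_ker hp) (hG.ext _)

lemma GtildeDimLe.of_extVanish {m k : ℕ} (h : GtildeDimLe R (m + k) (ModuleCat.of R A))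
    (hE : ∀ i ≥ m, ExtVanish R A R (i + 1)) : GtildeDimLe R m (ModuleCat.of R A) := by
  induction m generalizing A with
  | zero =>
    rw [Nat.zero_add] at h
    induction k generalizing A with
    | zero => exact h
    | succ k ih =>
      obtain ⟨G, _, _, p, hG, hp, hk⟩ := h.exists
      have hK := ih hk fun i _ => (hG.ext i).left (.of_ker hp) (hE (i + 1) (Nat.zero_le _))
      exact gtildeDimLe_zero_iff.2 ((gtildeDimLe_zero_iff.1 hK).right (.of_ker hp) hG
        fun i => hE i (Nat.zero_le _))
  | succ m ih =>
    rw [Nat.succ_add] at h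
    obtain ⟨G, _, _, p, hG, hp, hk⟩ := h.exists
    exact gtildeDimLe_succ p hp hG
      (ih hk fun i hi => (hG.ext i).left (.of_ker hp) (hE (i + 1) (by omega)))

end Dimension

section Quotient

open Module

variable {R S : Type u} [CommRing R] [CommRing S] [Algebra R S] {x : R}

/-- Tensoring `0 → R → R → S → 0` with a module on which `x` is regular. -/
lemma IsSES.tensor (hS : IsSES (LinearMap.lsmul R R x) (Algebra.linearMap R S))
    {G : Type u} [AddCommGroup G] [Module R G] (hG : Function.Injective (LinearMap.lsmul R G x)) :
    IsSES (LinearMap.lsmul R G x) (TensorProduct.mk R S G 1) := by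
  have hr := rTensor_exact G hS.exact hS.surj
  have hsurj : Function.Surjective (TensorProduct.mk R S G 1) := by
    intro t
    obtain ⟨t, rfl⟩ := LinearMap.rTensor_surjective G hS.surj t
    obtain ⟨t, rfl⟩ := (TensorProduct.lid R G).symm.surjective t
    exact ⟨t, by simp⟩
  refine ⟨hG, fun y => ?_, hsurj⟩
  have := hr ((TensorProduct.lid R G).symm y)
  simp only [TensorProduct.lid_symm_apply, LinearMap.rTensor_tmul, Algebra.linearMap_apply,
    map_one] at this
  rw [TensorProduct.mk_apply, this]
  constructor
  · rintro ⟨t, ht⟩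
    obtain ⟨t, rfl⟩ := (TensorProduct.lid R G).symm.surjective t
    refine ⟨t, ?_⟩
    have := congrArg (TensorProduct.lid R G) ht
    simpa using this
  · rintro ⟨t, rfl⟩
    exact ⟨1 ⊗ₜ t, by simp [TensorProduct.smul_tmul']⟩

lemma smul_eq_zero_of_isSES (hS : IsSES (LinearMap.lsmul R R x) (Algebra.linearMap R S))
    {M : Type*} [AddCommGroup M] [Module R M] [Module S M] [IsScalarTower R S M] (m : M) :
    x • m = 0 := by
  have : algebraMap R S x = 0 := by simpa using hS.apply_apply 1
  rw [← algebraMap_smul S x m, this, zero_smul]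

lemma isFPInf_pi (hS : IsSES (LinearMap.lsmul R R x) (Algebra.linearMap R S)) (k : ℕ) :
    IsFPInf R (ModuleCat.of R (Fin k → S)) := by
  have h : IsSES (LinearMap.lsmul R (Fin k → R) x)
      (LinearMap.compLeft (Algebra.linearMap R S) (Fin k)) := by
    refine ⟨fun v w h => funext fun i => hS.inj (congrFun h i), fun v => ⟨fun h => ?_, ?_⟩, ?_⟩
    · choose w hw using fun i => hS.exists_of_apply_eq_zero (congrFun h i)
      exact ⟨w, funext hw⟩
    · rintro ⟨w, rfl⟩
      exact funext fun i => hS.apply_apply (w i)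
    · intro v
      choose w hw using fun i => hS.surj (v i)
      exact ⟨w, funext hw⟩
  exact .right h isFP_of_free isFP_of_free

lemma IsFP.of_restrictScalars (hS : IsSES (LinearMap.lsmul R R x) (Algebra.linearMap R S))
    {M : Type u} [AddCommGroup M] [Module R M] [Module S M] [IsScalarTower R S M] {n : ℕ}
    (h : IsFP R n (ModuleCat.of R M)) : IsFP S n (ModuleCat.of S M) := by
  induction n generalizing M with
  | zero =>
    have : Module.Finite R M := h
    exact Module.Finite.of_restrictScalars_finite R S M
  | succ n ih =>
    have : Module.Finite R M := by
      obtain ⟨k, f, hf, _⟩ := h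
      exact Module.Finite.of_surjective f hf
    have := Module.Finite.of_restrictScalars_finite R S M
    obtain ⟨k, f, hf⟩ := Module.Finite.exists_fin' S M
    exact ⟨k, f, hf, ih ((isFPInf_pi hS k n).left ((IsSES.of_ker hf).restrictScalars (R₀ := R)) h)⟩

/-- Every class in `Ext¹_R(P, R)` comes from a map `P → S` when `x` kills `P`. -/
lemma exists_comp_extClass (hS : IsSES (LinearMap.lsmul R R x) (Algebra.linearMap R S))
    {P : Type u} [AddCommGroup P] [Module R P] (hP : ∀ p : P, x • p = 0)
    (e : Abelian.Ext (ModuleCat.of R P) (ModuleCat.of R R) 1) :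
    ∃ φ : P →ₗ[R] S, (Abelian.Ext.mk₀ (ModuleCat.ofHom φ)).comp hS.shortExact.extClass
      (zero_add 1) = e := by
  have he : e.comp (Abelian.Ext.mk₀ (sc hS.exact).f) (add_zero 1) = 0 := by
    have h₁ : (sc hS.exact).f = x • 𝟙 (ModuleCat.of R R) := by ext; simp
    have h₂ : x • 𝟙 (ModuleCat.of R P) = 0 := by ext p; exact hP p
    rw [h₁, ← Abelian.Ext.smul_eq_comp_mk₀, ← Abelian.Ext.mk₀_id_comp e,
      ← Abelian.Ext.smul_comp, ← Abelian.Ext.mk₀_smul, h₂, Abelian.Ext.mk₀_zero,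
      Abelian.Ext.zero_comp]
  obtain ⟨b, hb⟩ := Abelian.Ext.covariant_sequence_exact₁ _ hS.shortExact e he (zero_add 1)
  obtain ⟨φ, rfl⟩ := (Abelian.Ext.mk₀_bijective _ _).2 b
  exact ⟨φ.hom, hb⟩

lemma eq_zero_of_comp_extClass (hS : IsSES (LinearMap.lsmul R R x) (Algebra.linearMap R S))
    {P : Type u} [AddCommGroup P] [Module R P] (hP : ∀ p : P, x • p = 0) (φ : P →ₗ[R] S)
    (hφ : (Abelian.Ext.mk₀ (ModuleCat.ofHom φ)).comp hS.shortExact.extClass (zero_add 1) = 0) :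
    φ = 0 := by
  obtain ⟨b, hb⟩ := Abelian.Ext.covariant_sequence_exact₃ _ hS.shortExact _ _ hφ
  obtain ⟨ψ, rfl⟩ := (Abelian.Ext.mk₀_bijective _ _).2 b
  rw [Abelian.Ext.mk₀_comp_mk₀] at hb
  have := (Abelian.Ext.mk₀_bijective _ _).1 hb
  ext p
  have h₁ : ψ.hom p = 0 := hS.inj (by
    rw [map_zero, LinearMap.lsmul_apply, ← map_smul, hP, map_zero])
  have h₂ := congrArg (fun t => t.hom p) this
  refine h₂.symm.trans ?_
  change algebraMap R S (ψ.hom p) = 0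
  rw [h₁, map_zero]

lemma extVanish_finsupp (hS : IsSES (LinearMap.lsmul R R x) (Algebra.linearMap R S)) (ι : Type u)
    (i : ℕ) : ExtVanish R (ι →₀ S) R (i + 2) := by
  have h : IsSES (LinearMap.lsmul R (ι →₀ R) x)
      (Finsupp.mapRange.linearMap (α := ι) (Algebra.linearMap R S)) := by
    refine ⟨fun v w h => Finsupp.ext fun i => hS.inj (DFunLike.congr_fun h i),
      fun v => ⟨fun h => ?_, ?_⟩, Finsupp.mapRange_surjective _ (map_zero _) hS.surj⟩
    · have H (i) : ∃ r, x * r = v i := hS.exists_of_apply_eq_zero (DFunLike.congr_fun h i)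
      choose w hw using H
      refine ⟨Finsupp.onFinset v.support w fun i hi => ?_, Finsupp.ext hw⟩
      rw [Finsupp.mem_support_iff, ← hw]
      refine fun h0 => hi (hS.inj ?_)
      simpa using h0
    · rintro ⟨w, rfl⟩
      exact Finsupp.ext fun i => hS.apply_apply (w i)
  exact (extVanish_of_projective i).right h (extVanish_of_projective (i + 1))

lemma extVanish_one_iff (hS : IsSES (LinearMap.lsmul R R x) (Algebra.linearMap R S))
    {K F M : Type u} [AddCommGroup K] [Module R K] [Module S K] [IsScalarTower R S K]
    [AddCommGroup F] [Module R F] [Module S F] [IsScalarTower R S F]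
    [AddCommGroup M] [Module R M] [Module S M] [IsScalarTower R S M]
    {f : K →ₗ[S] F} {g : F →ₗ[S] M} (h : IsSES f g) [Module.Projective S F]
    (hF : ExtVanish R F R 2) : ExtVanish S M S 1 ↔ ExtVanish R M R 2 := by
  have hR := h.restrictScalars (R₀ := R)
  have hK := smul_eq_zero_of_isSES hS (M := K)
  have hF' := smul_eq_zero_of_isSES hS (M := F)
  constructor
  · intro hM
    rw [extVanish_iff] at *
    intro c
    obtain ⟨a, rfl⟩ := Abelian.Ext.contravariant_sequence_exact₃ hR.shortExact _ c (hF _)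
      (add_comm 1 1)
    obtain ⟨φ, rfl⟩ := exists_comp_extClass hS hK a
    obtain ⟨ψ, hψ⟩ := (extVanish_iff.2 hM).extend h (LinearMap.extendScalarsOfSurjective hS.surj φ)
    have : ModuleCat.ofHom φ = (sc hR.exact).f ≫ ModuleCat.ofHom (ψ.restrictScalars R) := by
      ext k; exact (hψ k).symm
    rw [this, ← Abelian.Ext.mk₀_comp_mk₀_assoc, hR.shortExact.extClass_comp_assoc]
  · intro hM
    refine .one_of_extend h (extVanish_of_projective 0) fun φ => ?_
    rw [extVanish_iff] at hM
    obtain ⟨b, hb⟩ := Abelian.Ext.contravariant_sequence_exact₁ hR.shortExact _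
      ((Abelian.Ext.mk₀ (ModuleCat.ofHom (φ.restrictScalars R))).comp hS.shortExact.extClass
        (zero_add 1)) (add_comm 1 1) (hM _)
    obtain ⟨ψ, rfl⟩ := exists_comp_extClass hS hF' b
    have h₀ := eq_zero_of_comp_extClass hS hK (ψ ∘ₗ f.restrictScalars R - φ.restrictScalars R) ?_
    · exact ⟨LinearMap.extendScalarsOfSurjective hS.surj ψ,
        fun a => sub_eq_zero.1 (LinearMap.congr_fun h₀ a)⟩
    · have : ModuleCat.ofHom (ψ ∘ₗ f.restrictScalars R - φ.restrictScalars R) =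
          (sc hR.exact).f ≫ ModuleCat.ofHom ψ - ModuleCat.ofHom (φ.restrictScalars R) := rfl
      rw [this, sub_eq_add_neg, Abelian.Ext.mk₀_add, Abelian.Ext.mk₀_neg, Abelian.Ext.add_comp,
        Abelian.Ext.neg_comp, ← Abelian.Ext.mk₀_comp_mk₀_assoc, hb, add_neg_cancel]

/-- Rees' change of rings for the vanishing of `Ext`. -/
lemma extVanish_quotient_iff (hS : IsSES (LinearMap.lsmul R R x) (Algebra.linearMap R S))
    {M : Type u} [AddCommGroup M] [Module R M] [Module S M] [IsScalarTower R S M] (i : ℕ) :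
    ExtVanish S M S (i + 1) ↔ ExtVanish R M R (i + 2) := by
  induction i generalizing M with
  | zero =>
    exact extVanish_one_iff hS (.of_ker (Finsupp.linearCombination_id_surjective S M))
      (extVanish_finsupp hS M 0)
  | succ i ih =>
    have h := IsSES.of_ker (Finsupp.linearCombination_id_surjective S M)
    have hR := h.restrictScalars (R₀ := R)
    have hF := extVanish_finsupp hS M
    trans ExtVanish S (LinearMap.ker (Finsupp.linearCombination S (id : M → M))) S (i + 1)
    · exact ⟨fun hM => (extVanish_of_projective i).left h hM,
        fun hK => hK.right h (extVanish_of_projective (i + 1))⟩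
    · rw [ih]
      exact ⟨fun hK => hK.right hR (hF (i + 1)), fun hM => (hF i).left hR hM⟩

end Quotient

section QuotientDimension

open Module

variable {R S : Type u} [CommRing R] [CommRing S] [Algebra R S] {x : R}

lemma algebraMap_eq_zero_of_isSES
    (hS : IsSES (LinearMap.lsmul R R x) (Algebra.linearMap R S)) (r : R) :
    algebraMap R S (x * r) = 0 := hS.apply_apply r

lemma exists_linearMap_mul_eq (hS : IsSES (LinearMap.lsmul R R x) (Algebra.linearMap R S))
    {P : Type*} [AddCommGroup P] [Module R P] (φ : P →ₗ[R] R)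
    (hφ : ∀ p, algebraMap R S (φ p) = 0) : ∃ ψ : P →ₗ[R] R, ∀ p, x * ψ p = φ p :=
  hS.exists_factor φ hφ

lemma eq_of_smul_eq (hS : IsSES (LinearMap.lsmul R R x) (Algebra.linearMap R S))
    {G : Type u} [AddCommGroup G] [Module R G] [IsReflexive R G] {a b : G} (h : x • a = x • b) :
    a = b := by
  rw [← sub_eq_zero]
  refine eq_zero_of_dual (R := R) fun ψ => hS.inj ?_
  rw [LinearMap.lsmul_apply, ← map_smul, smul_sub, h, sub_self, map_zero, map_zero]

variable {M : Type u} [AddCommGroup M] [Module R M] [Module S M] [IsScalarTower R S M]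
variable {G G' : Type u} [AddCommGroup G] [Module R G] [AddCommGroup G'] [Module R G']
  {f : G' →ₗ[R] G} {π : G →ₗ[R] M}

/-- The dual over `S` of a module with a resolution by `G`-modules over `R` of length one. -/
lemma IsSES.exists_dual (hS : IsSES (LinearMap.lsmul R R x) (Algebra.linearMap R S))
    (h : IsSES f π) (hG : ExtVanish R G R 1) {g : G →ₗ[R] G'} (hfg : ∀ a, f (g a) = x • a)
    (hgf : ∀ c, g (f c) = x • c) :
    ∃ β : Dual R G' →ₗ[R] Dual S M, IsSES f.dualMap β ∧
      ∀ b a, β b (π a) = algebraMap R S (b (g a)) := by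
  have H (b : Dual R G') : ∃ ψ : M →ₗ[S] S, ∀ a, ψ (π a) = algebraMap R S (b (g a)) := by
    obtain ⟨ψ, hψ⟩ := h.exists_descend (Algebra.linearMap R S ∘ₗ b ∘ₗ g) fun c => by
      simpa [hgf] using algebraMap_eq_zero_of_isSES hS (b c)
    exact ⟨LinearMap.extendScalarsOfSurjective hS.surj ψ, hψ⟩
  choose β hβ using H
  have hext {φ ψ : M →ₗ[S] S} (H : ∀ a, φ (π a) = ψ (π a)) : φ = ψ :=
    LinearMap.ext fun m => by obtain ⟨a, rfl⟩ := h.surj m; exact H a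
  refine ⟨⟨⟨β, fun b c => hext fun a => ?_⟩, fun r b => hext fun a => ?_⟩, ⟨?_, ?_, ?_⟩, hβ⟩
  · simp [hβ]
  · simp [hβ, Algebra.smul_def]
  · rw [injective_iff_map_eq_zero]
    refine fun d hd => LinearMap.ext fun a => hS.inj ?_
    have := LinearMap.congr_fun hd (g a)
    rw [LinearMap.dualMap_apply, hfg, map_smul] at this
    simpa using this
  · intro b
    constructor
    · intro hb
      obtain ⟨d, hd⟩ := exists_linearMap_mul_eq hS (b ∘ₗ g) fun a =>
        (hβ b a).symm.trans (LinearMap.congr_fun hb (π a))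
      refine ⟨d, LinearMap.ext fun c => hS.inj ?_⟩
      have := hd (f c)
      rw [LinearMap.comp_apply, hgf, map_smul] at this
      exact this
    · rintro ⟨d, rfl⟩
      refine hext fun a => (hβ _ a).trans ?_
      rw [LinearMap.dualMap_apply, hfg, map_smul]
      exact algebraMap_eq_zero_of_isSES hS _
  · intro φ
    obtain ⟨θ, hθ⟩ := hG.lift hS (φ.restrictScalars R ∘ₗ π)
    obtain ⟨ψ, hψ⟩ := exists_linearMap_mul_eq hS (θ ∘ₗ f) fun c =>
      (hθ (f c)).trans (by simp [h.apply_apply])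
    refine ⟨ψ, hext fun a => (hβ ψ a).trans ?_⟩
    refine .trans ?_ (hθ a)
    refine congrArg (algebraMap R S) (hS.inj ?_)
    refine (hψ (g a)).trans ?_
    rw [LinearMap.comp_apply, hfg, map_smul]
    rfl

lemma IsGtilde.of_isSES (hS : IsSES (LinearMap.lsmul R R x) (Algebra.linearMap R S))
    (h : IsSES f π) (hG' : IsGtilde R G') (hG : IsGtilde R G) : IsGtilde S M := by
  have := hG.refl
  have := hG'.refl
  obtain ⟨g, hfg⟩ := h.exists_factor (LinearMap.lsmul R G x) fun a => by
    rw [LinearMap.lsmul_apply, map_smul, smul_eq_zero_of_isSES hS]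
  replace hfg (a : G) : f (g a) = x • a := hfg a
  have hgf (c : G') : g (f c) = x • c := h.inj (by simp [hfg])
  obtain ⟨β, hβ, hβg⟩ := IsSES.exists_dual hS h (hG.ext 0) hfg hgf
  refine ⟨isReflexive_of_forall (fun m hm => ?_) fun Φ => ?_,
    fun n => .of_restrictScalars hS (hG'.fp.right h hG.fp n),
    fun n => .of_restrictScalars hS (hG.fp_dual.right hβ hG'.fp_dual n),
    fun i => (extVanish_quotient_iff hS i).2 ((hG'.ext i).right h (hG.ext (i + 1))),
    fun i => (extVanish_quotient_iff hS i).2 ((hG.ext_dual i).right hβ (hG'.ext_dual (i + 1)))⟩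
  · obtain ⟨a, rfl⟩ := h.surj m
    obtain ⟨Ψ, hΨ⟩ := exists_linearMap_mul_eq hS (Dual.eval R G' (g a)) fun b =>
      (hβg b a).symm.trans (hm _)
    obtain ⟨c, hc⟩ := exists_eval Ψ
    have h₁ : g a = x • c := by
      rw [← sub_eq_zero]
      refine eq_zero_of_dual (R := R) fun b => ?_
      rw [map_sub, map_smul, ← hc, sub_eq_zero]
      exact (hΨ b).symm
    have h₂ : a = f c := eq_of_smul_eq hS (by rw [← hfg, h₁, map_smul])
    rw [h₂, h.apply_apply]
  · obtain ⟨Ψ, hΨ⟩ := (hG'.ext_dual 0).lift hS (Φ.restrictScalars R ∘ₗ β)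
    obtain ⟨c, hc⟩ := exists_eval Ψ
    obtain ⟨Θ, hΘ⟩ := exists_linearMap_mul_eq hS (Dual.eval R G (f c)) fun d => by
      refine (congrArg (algebraMap R S) (hc (f.dualMap d)).symm).trans ((hΨ _).trans ?_)
      simp [hβ.apply_apply]
    obtain ⟨a, ha⟩ := exists_eval Θ
    have h₁ : x • a = f c := by
      rw [← sub_eq_zero]
      refine eq_zero_of_dual (R := R) fun d => ?_
      rw [map_sub, map_smul, ← ha, sub_eq_zero]
      exact hΘ d
    have h₂ : c = g a := h.inj (by rw [hfg, h₁])
    refine ⟨π a, fun φ => ?_⟩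
    obtain ⟨b, rfl⟩ := hβ.surj φ
    rw [hβg, ← h₂, ← hc]
    exact (hΨ b).symm

lemma GtildeDimLe.of_isSES (hS : IsSES (LinearMap.lsmul R R x) (Algebra.linearMap R S)) {n : ℕ}
    (h : GtildeDimLe R (n + 1) (ModuleCat.of R M)) : GtildeDimLe S n (ModuleCat.of S M) := by
  obtain ⟨G, _, _, p, hG, hp, hk⟩ := h.exists
  induction n generalizing M G with
  | zero =>
    exact gtildeDimLe_zero_iff.2 (.of_isSES hS (.of_ker hp) (gtildeDimLe_zero_iff.1 hk) hG)
  | succ n ih =>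
    have := hG.refl
    have ht := hS.tensor (G := G) fun _ _ => eq_of_smul_eq hS
    let q : S ⊗[R] G →ₗ[S] M := LinearMap.liftBaseChange S p
    have hq : Function.Surjective q := fun m => by
      obtain ⟨a, rfl⟩ := hp m
      exact ⟨1 ⊗ₜ a, by simp [q]⟩
    refine gtildeDimLe_succ q hq (.of_isSES hS ht hG hG) ?_
    have hpx (a : G) : x • a ∈ LinearMap.ker p := by
      rw [LinearMap.mem_ker, map_smul, smul_eq_zero_of_isSES hS]
    let r : LinearMap.ker p →ₗ[R] LinearMap.ker q :=
      { toFun a := ⟨1 ⊗ₜ a.1, by simp [q]⟩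
        map_add' a b := Subtype.ext (tmul_add _ _ _)
        map_smul' c a := Subtype.ext (tmul_smul _ _ _) }
    have hK : IsSES (C := LinearMap.ker q)
        ((LinearMap.lsmul R G x).codRestrict (LinearMap.ker p) hpx) r := by
      refine ⟨fun a b hab => ht.inj (congrArg Subtype.val hab), fun k => ⟨fun hk => ?_, ?_⟩, ?_⟩
      · obtain ⟨a, ha⟩ := ht.exists_of_apply_eq_zero (congrArg Subtype.val hk)
        exact ⟨a, Subtype.ext ha⟩
      · rintro ⟨a, rfl⟩
        exact Subtype.ext (ht.apply_apply a)
      · rintro ⟨t, h_t⟩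
        obtain ⟨a, rfl⟩ := ht.surj t
        exact ⟨⟨a, by simpa [q] using h_t⟩, rfl⟩
    obtain ⟨G₁, _, _, p₁, hG₁, hp₁, hk₁⟩ := hk.exists
    obtain ⟨i, j, hij⟩ := hK.exists_ker_comp p₁ hp₁
    have hk₂ := hk₁.mid hij hG
    have hrp : Function.Surjective (r ∘ₗ p₁) := hK.surj.comp hp₁
    exact ih (M := LinearMap.ker q) (gtildeDimLe_succ _ hrp hG₁ hk₂) _ _ _ _ hG₁ hrp hk₂

lemma gtildeDim_eq {n : ℕ} (h : GtildeDimLe R n (ModuleCat.of R M))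
    (hlt : ∀ m < n, ¬ GtildeDimLe R m (ModuleCat.of R M)) : GtildeDim R (ModuleCat.of R M) = n := by
  refine le_antisymm (sInf_le ⟨n, rfl, h⟩) (le_sInf ?_)
  rintro _ ⟨m, rfl, hm⟩
  exact Nat.cast_le.2 (not_lt.1 fun hmn => hlt m hmn hm)

lemma exists_gtildeDimLe (h : GtildeDim R (ModuleCat.of R M) ≠ ⊤) :
    ∃ n, GtildeDimLe R n (ModuleCat.of R M) := by
  by_contra! H
  exact h (sInf_eq_top.2 (by rintro _ ⟨m, -, hm⟩; exact absurd hm (H m)))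

end QuotientDimension

end AB

open AB in
theorem gtildeDim_over_quotient (R : Type u) [CommRing R] (x : R)
    (hx : x ∈ nonZeroDivisors R)
    (M : Type u) [AddCommGroup M] [Module R M] [Module (R ⧸ Ideal.span {x}) M]
    (hcompat : ∀ (r : R) (m : M), (Ideal.Quotient.mk (Ideal.span {x}) r) • m = r • m)
    (hxM : ∀ m : M, x • m = 0)
    (hM0 : Nontrivial M) (hfin : AB.GtildeDim R (ModuleCat.of R M) ≠ ⊤) :
    AB.GtildeDim (R ⧸ Ideal.span {x}) (ModuleCat.of (R ⧸ Ideal.span {x}) M) =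
      AB.GtildeDim R (ModuleCat.of R M) - 1 := by
  have : IsScalarTower R (R ⧸ Ideal.span {x}) M := .of_algebraMap_smul hcompat
  have hinj : Function.Injective (LinearMap.lsmul R R x) := fun a b hab =>
    (mul_cancel_left_mem_nonZeroDivisors hx).1 hab
  have hS : IsSES (LinearMap.lsmul R R x) (Algebra.linearMap R (R ⧸ Ideal.span {x})) :=
    ⟨hinj, fun r => Ideal.Quotient.eq_zero_iff_mem.trans (Ideal.mem_span_singleton'.trans
      ⟨fun ⟨a, ha⟩ => ⟨a, (mul_comm _ _).trans ha⟩, fun ⟨a, ha⟩ => ⟨a, (mul_comm _ _).trans ha⟩⟩),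
      Ideal.Quotient.mk_surjective⟩
  classical
  have hex := exists_gtildeDimLe hfin
  have hn := Nat.find_spec hex
  have hmin := fun m (hm : m < Nat.find hex) => Nat.find_min hex hm
  generalize Nat.find hex = n at hn hmin
  rw [gtildeDim_eq hn hmin]
  cases n with
  | zero =>
    have := (gtildeDimLe_zero_iff.1 hn).refl
    obtain ⟨m, hm⟩ := exists_ne (0 : M)
    refine absurd (eq_zero_of_dual fun ψ => hinj ?_) hm
    rw [LinearMap.lsmul_apply, ← map_smul, hxM, map_zero, map_zero]
  | succ n =>
    rw [gtildeDim_eq (n := n) (.of_isSES hS hn) fun m hm h => ?_]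
    · rw [← ENat.natCast_one, ← ENat.natCast_sub, Nat.add_sub_cancel]
    · obtain ⟨k, rfl⟩ := Nat.exists_eq_add_of_lt hm
      refine hmin (m + 1) (by omega) (.of_extVanish (k := k + 1) ?_ fun i hi => ?_)
      · convert hn using 1; omega
      · obtain ⟨i, rfl⟩ := Nat.exists_eq_succ_of_ne_zero (by omega : i ≠ 0)
        exact (extVanish_quotient_iff hS i).1 (h.extVanish (by omega))
end

section
/- Let R be a quasi-local ring and M a nonzero R-module in the restricted G-class G̃(R). Then depth M = depth R (including the case where both are infinite). -/
open CategoryTheory Opposite TensorProduct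

universe u

namespace AB

open RingTheory.Sequence Polynomial

/-- Vanishing of the derived-functor `Ext` implies vanishing of `Abelian.Ext`. -/
theorem subsingleton_abelianExt_of_extZero {R : Type u} [CommRing R] {M N : ModuleCat.{u} R}
    {i : ℕ} (hi : 0 < i) (h : extZero R M N i) : Subsingleton (Abelian.Ext M N i) := by
  obtain ⟨j, rfl⟩ : ∃ j, i = j + 1 := ⟨i - 1, by omega⟩
  let P := projectiveResolution M
  have hz : Limits.IsZero ((P.complex.linearYonedaObj R N).homology (j + 1)) :=
    Limits.IsZero.of_iso (@ModuleCat.isZero_of_subsingleton _ _ _ h) (P.isoExt (j + 1) N).symm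
  rw [← HomologicalComplex.exactAt_iff_isZero_homology,
    HomologicalComplex.exactAt_iff' _ j (j + 1) (j + 2) (by simp) (by simp),
    ShortComplex.moduleCat_exact_iff] at hz
  refine subsingleton_of_forall_eq 0 fun α => ?_
  obtain ⟨f, hf, rfl⟩ := P.extMk_surjective α (j + 2) rfl
  rw [P.extMk_eq_zero_iff f (j + 2) rfl hf j rfl]
  exact hz f hf

theorem shortExact_of_surjective {R : Type u} [CommRing R] {F N : Type u} [AddCommGroup F]
    [Module R F] [AddCommGroup N] [Module R N] {p : F →ₗ[R] N} (hp : Function.Surjective p) :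
    (ShortComplex.mk (ModuleCat.ofHom (LinearMap.ker p).subtype) (ModuleCat.ofHom p)
      (by ext x; exact x.2)).ShortExact where
  exact := by
    rw [ShortComplex.moduleCat_exact_iff]
    intro x hx
    exact ⟨⟨x, hx⟩, rfl⟩
  mono_f := (ModuleCat.mono_iff_injective _).2 Subtype.val_injective
  epi_g := (ModuleCat.epi_iff_surjective _).2 hp

theorem subsingleton_ext_ker_s16 {R : Type u} [CommRing R] {F N L : Type u} [AddCommGroup F]
    [Module R F] [Module.Projective R F] [AddCommGroup N] [Module R N] [AddCommGroup L]
    [Module R L] {p : F →ₗ[R] N}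
    (hp : Function.Surjective p) {i : ℕ}
    (hi : 0 < i) (h : Subsingleton (Abelian.Ext (ModuleCat.of R N) (ModuleCat.of R L) (1 + i))) :
    Subsingleton (Abelian.Ext (ModuleCat.of R (LinearMap.ker p)) (ModuleCat.of R L) i) := by
  refine subsingleton_of_forall_eq 0 fun α => ?_
  obtain ⟨β, rfl⟩ := Abelian.Ext.contravariant_sequence_exact₁ (shortExact_of_surjective hp) _
    α rfl (Subsingleton.elim _ _)
  obtain ⟨j, rfl⟩ : ∃ j, i = j + 1 := ⟨i - 1, by omega⟩
  have : Projective (ModuleCat.of R F) := (IsProjective.iff_projective F).1 inferInstance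
  rw [Abelian.Ext.eq_zero_of_projective β, Abelian.Ext.comp_zero]

theorem exists_extend_of_subsingleton_ext {R : Type u} [CommRing R] {F N L : Type u}
    [AddCommGroup F] [Module R F] [AddCommGroup N] [Module R N] [AddCommGroup L] [Module R L]
    {p : F →ₗ[R] N} (hp : Function.Surjective p)
    (h : Subsingleton (Abelian.Ext (ModuleCat.of R N) (ModuleCat.of R L) 1))
    (φ : LinearMap.ker p →ₗ[R] L) : ∃ ψ : F →ₗ[R] L, ψ ∘ₗ (LinearMap.ker p).subtype = φ := by
  obtain ⟨β, hβ⟩ := Abelian.Ext.contravariant_sequence_exact₁ (shortExact_of_surjective hp) _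
    (Abelian.Ext.mk₀ (ModuleCat.ofHom φ)) (add_zero 1) (Subsingleton.elim _ _)
  obtain ⟨ψ, rfl⟩ := (Abelian.Ext.mk₀_bijective _ _).2 β
  rw [Abelian.Ext.mk₀_comp_mk₀] at hβ
  have := (Abelian.Ext.mk₀_bijective _ _).1 hβ
  exact ⟨ψ.hom, congrArg ModuleCat.Hom.hom this⟩

/-- `Extⁱ(T ⧸ J, N)` vanishes below the length of any weakly `N`-regular sequence in `J`. -/
theorem subsingleton_ext_of_isWeaklyRegular {T : Type u} [CommRing T] {J : Ideal T}
    {rs : List T} (hrs : ∀ r ∈ rs, r ∈ J) {N : Type u} [AddCommGroup N] [Module T N]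
    (reg : RingTheory.Sequence.IsWeaklyRegular N rs) {i : ℕ} (hi : i < rs.length) :
    Subsingleton (Abelian.Ext (ModuleCat.of T (T ⧸ J)) (ModuleCat.of T N) i) := by
  induction rs generalizing N i with
  | nil => simp at hi
  | cons a rs ih =>
    rw [RingTheory.Sequence.isWeaklyRegular_cons_iff] at reg
    have ha : a ∈ Module.annihilator T (T ⧸ J) := by
      rw [Ideal.annihilator_quotient]; exact hrs a (by simp)
    have hreg : IsSMulRegular (Abelian.Ext (ModuleCat.of T (T ⧸ J)) (ModuleCat.of T N) i) a := by
      rw [← Abelian.Ext.postcomp_smul_id_mono_iff]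
      cases i with
      | zero =>
        rw [AddCommGrpCat.mono_iff_injective]
        have : Mono (a • 𝟙 (ModuleCat.of T N)) := reg.1.smulShortComplex_shortExact.mono_f
        exact Abelian.Ext.postcomp_mk₀_injective_of_mono _ _
      | succ i =>
        refine (Abelian.Ext.covariant_sequence_exact₁' _ reg.1.smulShortComplex_shortExact i
          (i + 1) rfl).mono_g
          ((AddCommGrpCat.isZero_of_iff_subsingleton.mpr ?_).eq_zero_of_src _)
        exact ih (fun r hr => hrs r (by simp [hr])) reg.2 (by simpa using hi)
    have hzero := Abelian.Ext.postcomp_smul_id_eq_zero_of_mem_annihilator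
      (M := ModuleCat.of T N) (N := ModuleCat.of T (T ⧸ J)) ha i
    have hmono := (Abelian.Ext.postcomp_smul_id_mono_iff (M := ModuleCat.of T N) a i).2 hreg
    exact AddCommGrpCat.subsingleton_of_isZero (Limits.IsZero.of_mono_eq_zero _ hzero)

theorem mk_mem_smul_top_iff {T N : Type*} [CommRing T] [AddCommGroup N] [Module T N]
    (a : T) (I : Ideal T) (n : N) :
    (Submodule.Quotient.mk n : QuotSMulTop a N) ∈ I • (⊤ : Submodule T (QuotSMulTop a N)) ↔
      n ∈ (Ideal.span {a} ⊔ I) • (⊤ : Submodule T N) := by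
  rw [← Submodule.mkQ_apply, ← Submodule.mem_comap,
    Submodule.comap_smul_top_of_surjective I _ (Submodule.mkQ_surjective _), Submodule.ker_mkQ,
    Submodule.sup_smul, Submodule.ideal_span_singleton_smul, sup_comm]

theorem mem_smul_top_of_subsingleton_ext {T : Type u} [CommRing T] {J : Ideal T}
    {xs : List T} {N : Type u} [AddCommGroup N] [Module T N]
    (reg : RingTheory.Sequence.IsWeaklyRegular N xs)
    (h : ∀ i ≤ xs.length,
      Subsingleton (Abelian.Ext (ModuleCat.of T (T ⧸ J)) (ModuleCat.of T N) i))
    {n : N} (hn : ∀ j ∈ J, j • n ∈ Ideal.ofList xs • (⊤ : Submodule T N)) :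
    n ∈ Ideal.ofList xs • (⊤ : Submodule T N) := by
  induction xs generalizing N with
  | nil =>
    simp only [Ideal.ofList_nil, Submodule.bot_smul, Submodule.mem_bot] at hn ⊢
    have h0 := h 0 le_rfl
    have : Subsingleton ((T ⧸ J) →ₗ[T] N) :=
      (Abelian.Ext.addEquiv₀.trans (ModuleCat.homAddEquiv (M := ModuleCat.of T (T ⧸ J))
        (N := ModuleCat.of T N))).symm.subsingleton
    let φ : (T ⧸ J) →ₗ[T] N :=
      Submodule.liftQ J (LinearMap.toSpanSingleton T N n) fun j hj => hn j hj
    calc n = φ (Submodule.Quotient.mk 1) := by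
            change n = (1 : T) • n
            rw [one_smul]
      _ = 0 := by rw [Subsingleton.elim φ 0, LinearMap.zero_apply]
  | cons a xs ih =>
    rw [RingTheory.Sequence.isWeaklyRegular_cons_iff] at reg
    rw [Ideal.ofList_cons] at hn ⊢
    rw [← mk_mem_smul_top_iff]
    refine ih reg.2 (fun i hi => ?_) fun j hj => ?_
    · have h1 := AddCommGrpCat.isZero_of_iff_subsingleton.mpr (h i (by simp; omega))
      have h2 := AddCommGrpCat.isZero_of_iff_subsingleton.mpr (h (i + 1) (by simpa using hi))
      have hS : ((ModuleCat.of T N).smulShortComplex a).ShortExact :=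
        IsSMulRegular.smulShortComplex_shortExact (M := ModuleCat.of T N) reg.1
      exact AddCommGrpCat.subsingleton_of_isZero <| ShortComplex.Exact.isZero_of_both_zeros
        (Abelian.Ext.covariant_sequence_exact₃' (ModuleCat.of T (T ⧸ J)) hS i (i + 1) rfl)
        (h1.eq_zero_of_src _) (h2.eq_zero_of_tgt _)
    · rw [← Submodule.Quotient.mk_smul, mk_mem_smul_top_iff]
      exact hn j hj

/-- If `J` contains a weakly `N`-regular sequence `rs`, then for every shorter weakly `N`-regular
sequence `xs` (in `J` or not) no nonzero element of `N ⧸ (xs)N` is annihilated by `J`. -/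
theorem mem_smul_top_of_isWeaklyRegular {T : Type u} [CommRing T] {J : Ideal T}
    {rs xs : List T} (hrs : ∀ r ∈ rs, r ∈ J) (hlen : xs.length < rs.length)
    {N : Type u} [AddCommGroup N] [Module T N]
    (hr : RingTheory.Sequence.IsWeaklyRegular N rs)
    (hx : RingTheory.Sequence.IsWeaklyRegular N xs)
    {n : N} (hn : ∀ j ∈ J, j • n ∈ Ideal.ofList xs • (⊤ : Submodule T N)) :
    n ∈ Ideal.ofList xs • (⊤ : Submodule T N) :=
  mem_smul_top_of_subsingleton_ext hx
    (fun _ hi => subsingleton_ext_of_isWeaklyRegular hrs hr (hi.trans_lt hlen)) hn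

/-- `M` is an `n`-th syzygy of modules satisfying `P`: there is an exact sequence
`0 → M → G₁ → ⋯ → Gₙ` with each `Gᵢ` satisfying `P`. -/
def IsSyz {R : Type u} [CommRing R] (P : ModuleCat.{u} R → Prop) : ℕ → ModuleCat.{u} R → Prop
  | 0, _ => True
  | n + 1, M => ∃ (G C : ModuleCat.{u} R) (f : M →ₗ[R] G) (g : G →ₗ[R] C),
      P G ∧ Function.Injective f ∧ Function.Exact f g ∧ Function.Surjective g ∧ IsSyz P n C

theorem IsSyz.of_succ {R : Type u} [CommRing R] {P : ModuleCat.{u} R → Prop} {n : ℕ}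
    {M : ModuleCat.{u} R} (h : IsSyz P (n + 1) M) : IsSyz P n M := by
  induction n generalizing M with
  | zero => trivial
  | succ n ih =>
    obtain ⟨G, C, f, g, hG, hf, hfg, hg, hC⟩ := h
    exact ⟨G, C, f, g, hG, hf, hfg, hg, ih hC⟩

theorem IsSyz.of_le {R : Type u} [CommRing R] {P : ModuleCat.{u} R → Prop} {m n : ℕ}
    (hmn : m ≤ n) {M : ModuleCat.{u} R} (h : IsSyz P n M) : IsSyz P m M := by
  induction hmn with
  | refl => exact h
  | step _ ih => exact ih h.of_succ

theorem isWeaklyRegular_baseChange {R U : Type u} [CommRing R] [CommRing U] [Algebra R U]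
    {xs : List U} (hx : IsWeaklyRegular U xs) (G : Type u) [AddCommGroup G] [Module R G]
    [Module.Flat R G] : IsWeaklyRegular (U ⊗[R] G) xs :=
  ((TensorProduct.lid U (U ⊗[R] G)).isWeaklyRegular_congr xs).1 hx.isWeaklyRegular_rTensor

theorem IsSyz.baseChange {R U : Type u} [CommRing R] [CommRing U] [Algebra R U]
    [Module.Flat R U] {xs : List U} (hx : IsWeaklyRegular U xs) {n : ℕ} {M : ModuleCat.{u} R}
    (h : IsSyz (fun G => Module.Flat R G) n M) :
    IsSyz (fun G => IsWeaklyRegular G xs) n (ModuleCat.of U (U ⊗[R] M)) := by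
  induction n generalizing M with
  | zero => trivial
  | succ n ih =>
    obtain ⟨G, C, f, g, hG, hf, hfg, hg, hC⟩ := h
    exact ⟨ModuleCat.of U (U ⊗[R] G), ModuleCat.of U (U ⊗[R] C), f.baseChange U, g.baseChange U,
      isWeaklyRegular_baseChange hx G, Module.Flat.lTensor_preserves_injective_linearMap f hf,
      lTensor_exact U hfg hg, LinearMap.lTensor_surjective U hg, ih hC⟩

theorem quotSMulTop_map_injective {T M M' M'' : Type*} [CommRing T] [AddCommGroup M]
    [AddCommGroup M'] [AddCommGroup M''] [Module T M] [Module T M'] [Module T M'']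
    {f : M →ₗ[T] M'} {g : M' →ₗ[T] M''} {r : T} (hf : Function.Injective f)
    (hfg : Function.Exact f g) (hr : IsSMulRegular M'' r) :
    Function.Injective (QuotSMulTop.map r f) := by
  have h := QuotSMulTop.map_first_exact_on_four_term_exact_of_isSMulRegular_last (r := r)
    (f₁ := (0 : M →ₗ[T] M)) (f₂ := f) (f₃ := g)
    ((LinearMap.exact_zero_iff_injective M f).2 hf) hfg hr
  rw [map_zero] at h
  exact (LinearMap.exact_zero_iff_injective _ _).1 h

theorem IsSyz.isSMulRegular {T : Type u} [CommRing T] {r : T} {rs : List T} {n : ℕ}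
    {M : ModuleCat.{u} T} (h : IsSyz (fun G => IsWeaklyRegular G (r :: rs)) (n + 1) M) :
    IsSMulRegular M r := by
  obtain ⟨G, C, f, g, hG, hf, hfg, hg, hC⟩ := h
  exact ((isWeaklyRegular_cons_iff G r rs).1 hG).1.of_injective f hf

theorem IsSyz.quotSMulTop {T : Type u} [CommRing T] {r : T} {rs : List T} {n : ℕ}
    {M : ModuleCat.{u} T} (h : IsSyz (fun G => IsWeaklyRegular G (r :: rs)) (n + 1) M) :
    IsSyz (fun G => IsWeaklyRegular G rs) n (ModuleCat.of T (QuotSMulTop r M)) := by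
  induction n generalizing M with
  | zero => trivial
  | succ n ih =>
    obtain ⟨G, C, f, g, hG, hf, hfg, hg, hC⟩ := h
    exact ⟨ModuleCat.of T (QuotSMulTop r G), ModuleCat.of T (QuotSMulTop r C),
      QuotSMulTop.map r f, QuotSMulTop.map r g, ((isWeaklyRegular_cons_iff G r rs).1 hG).2,
      quotSMulTop_map_injective hf hfg hC.isSMulRegular,
      QuotSMulTop.map_exact r hfg hg, QuotSMulTop.map_surjective r hg, ih hC⟩

theorem IsSyz.isWeaklyRegular {T : Type u} [CommRing T] {rs : List T}
    {M : ModuleCat.{u} T} (h : IsSyz (fun G => IsWeaklyRegular G rs) rs.length M) :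
    IsWeaklyRegular M rs := by
  induction rs generalizing M with
  | nil => exact IsWeaklyRegular.nil T M
  | cons r rs ih => exact IsWeaklyRegular.cons h.isSMulRegular (ih h.quotSMulTop)

theorem mem_smul_top_of_map_mem {T M M' M'' : Type*} [CommRing T] [AddCommGroup M]
    [AddCommGroup M'] [AddCommGroup M''] [Module T M] [Module T M'] [Module T M'']
    {f : M →ₗ[T] M'} {g : M' →ₗ[T] M''} {rs : List T} (hf : Function.Injective f)
    (hfg : Function.Exact f g) (hg : Function.Surjective g) (hr : IsWeaklyRegular M'' rs)
    {m : M} (hm : f m ∈ Ideal.ofList rs • (⊤ : Submodule T M')) :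
    m ∈ Ideal.ofList rs • (⊤ : Submodule T M) := by
  have h := map_first_exact_on_four_term_right_exact_of_isSMulRegular_last
    ((LinearMap.exact_zero_iff_injective M f).2 hf) hfg hg hr
  obtain ⟨y, hy⟩ := (h (Submodule.Quotient.mk m)).1
    ((Submodule.Quotient.mk_eq_zero _).2 hm)
  obtain ⟨y, rfl⟩ := Submodule.Quotient.mk_surjective _ y
  rw [Submodule.mapQ_apply, LinearMap.zero_apply, Submodule.Quotient.mk_zero, eq_comm,
    Submodule.Quotient.mk_eq_zero] at hy
  exact hy

theorem exists_sub_mem_of_map_mem {T M M' M'' : Type*} [CommRing T] [AddCommGroup M]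
    [AddCommGroup M'] [AddCommGroup M''] [Module T M] [Module T M'] [Module T M'']
    {f : M →ₗ[T] M'} {g : M' →ₗ[T] M''} {I : Ideal T}
    (hfg : Function.Exact f g) (hg : Function.Surjective g)
    {y : M'} (hy : g y ∈ I • (⊤ : Submodule T M'')) :
    ∃ m, y - f m ∈ I • (⊤ : Submodule T M') := by
  rw [← Submodule.mem_comap, Submodule.comap_smul_top_of_surjective I g hg,
    Submodule.mem_sup] at hy
  obtain ⟨a, ha, b, hb, rfl⟩ := hy
  obtain ⟨m, rfl⟩ := (hfg b).1 hb
  exact ⟨m, by simpa using ha⟩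

theorem map_mem_smul_top {T M M' : Type*} [CommRing T] [AddCommGroup M]
    [AddCommGroup M'] [Module T M] [Module T M'] (f : M →ₗ[T] M') {I : Ideal T} {m : M}
    (hm : m ∈ I • (⊤ : Submodule T M)) : f m ∈ I • (⊤ : Submodule T M') :=
  Submodule.smul_top_le_comap_smul_top I f hm

/-- The first two steps of a coresolution: if `J` contains a weakly regular sequence on `M` longer
than `xs`, then elements of `G` that are, modulo `xs`, killed by `J` and by `g` vanish
modulo `xs`. -/
theorem mem_smul_top_of_exact {T M G C : Type u} [CommRing T] [AddCommGroup M]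
    [AddCommGroup G] [AddCommGroup C] [Module T M] [Module T G] [Module T C]
    {f : M →ₗ[T] G} {g : G →ₗ[T] C} {J : Ideal T} {rs xs : List T}
    (hf : Function.Injective f) (hfg : Function.Exact f g) (hg : Function.Surjective g)
    (hC : IsWeaklyRegular C xs) (hM : IsWeaklyRegular M xs)
    (hrs : ∀ r ∈ rs, r ∈ J) (hlen : xs.length < rs.length) (hr : IsWeaklyRegular M rs)
    {y : G} (hy : ∀ j ∈ J, j • y ∈ Ideal.ofList xs • (⊤ : Submodule T G))
    (hgy : g y ∈ Ideal.ofList xs • (⊤ : Submodule T C)) :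
    y ∈ Ideal.ofList xs • (⊤ : Submodule T G) := by
  obtain ⟨m, hm⟩ := exists_sub_mem_of_map_mem hfg hg hgy
  have hmem : m ∈ Ideal.ofList xs • (⊤ : Submodule T M) := by
    refine mem_smul_top_of_isWeaklyRegular hrs hlen hr hM fun j hj => ?_
    refine mem_smul_top_of_map_mem hf hfg hg hC ?_
    have := sub_mem (hy j hj) (Submodule.smul_mem _ j hm)
    rwa [smul_sub, sub_sub_cancel, ← map_smul] at this
  simpa using add_mem hm (map_mem_smul_top f hmem)

/-- The key step: regular sequences on `U ⊗ M` bound the annihilators in `U` modulo shorter regular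
sequences. -/
theorem mem_ofList_of_mul_mem {R U : Type u} [CommRing R] [CommRing U] [Algebra R U]
    [Module.Flat R U] {M G C G' C' : ModuleCat.{u} R} {f : M →ₗ[R] G} {g : G →ₗ[R] C}
    {f' : C →ₗ[R] G'} {g' : G' →ₗ[R] C'} [Module.Flat R G] [Module.Flat R G'] {n : ℕ}
    (hf : Function.Injective f) (hfg : Function.Exact f g) (hg : Function.Surjective g)
    (hf' : Function.Injective f') (hfg' : Function.Exact f' g') (hg' : Function.Surjective g')
    (hC' : IsSyz (fun G => Module.Flat R G) n C') {J : Ideal R} {w : G} {φ : G →ₗ[R] R}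
    (hφ : φ w = 1) (hw : f' (g w) ∈ J • (⊤ : Submodule R G'))
    {rs xs : List U} (hn : rs.length ≤ n) (hlen : xs.length < rs.length)
    (hrs : ∀ r ∈ rs, r ∈ J.map (algebraMap R U)) (hr : IsWeaklyRegular (U ⊗[R] M) rs)
    (hx : IsWeaklyRegular U xs) {z : U} (hz : ∀ j ∈ J, j • z ∈ Ideal.ofList xs) :
    z ∈ Ideal.ofList xs := by
  have hCs : IsSyz (fun G => Module.Flat R G) n C :=
    IsSyz.of_succ ⟨G', C', f', g', ‹_›, hf', hfg', hg', hC'⟩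
  have hMs : IsSyz (fun G => Module.Flat R G) n M :=
    IsSyz.of_succ ⟨G, C, f, g, ‹_›, hf, hfg, hg, hCs⟩
  have reg {N : ModuleCat.{u} R} (h : IsSyz (fun G => Module.Flat R G) n N) :
      IsWeaklyRegular (U ⊗[R] N) xs :=
    IsSyz.isWeaklyRegular (M := ModuleCat.of U (U ⊗[R] N))
      ((h.of_le (by omega)).baseChange hx)
  have hJ : ∀ j ∈ J.map (algebraMap R U), j * z ∈ Ideal.ofList xs := by
    intro j hj
    have : J.map (algebraMap R U) ≤
        Submodule.comap (LinearMap.mulRight U z) (Ideal.ofList xs) := by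
      rw [Ideal.map, Submodule.span_le]
      rintro _ ⟨j, hj, rfl⟩
      simpa [Algebra.smul_def] using hz j hj
    exact this hj
  have smul_mem {N : ModuleCat.{u} R} (v : U ⊗[R] N) {t : U} (ht : t ∈ Ideal.ofList xs) :
      t • v ∈ Ideal.ofList xs • (⊤ : Submodule U (U ⊗[R] N)) :=
    Submodule.smul_mem_smul ht trivial
  have key : z • ((1 : U) ⊗ₜ[R] w) ∈ Ideal.ofList xs • (⊤ : Submodule U (U ⊗[R] G)) := by
    refine mem_smul_top_of_exact (f := f.baseChange U) (g := g.baseChange U)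
      (Module.Flat.lTensor_preserves_injective_linearMap f hf)
      (lTensor_exact U hfg hg) (LinearMap.lTensor_surjective U hg) (reg hCs) (reg hMs) hrs hlen hr
      (fun j hj => ?_) ?_
    · rw [smul_smul]
      exact smul_mem _ (hJ j hj)
    · refine mem_smul_top_of_map_mem (f := f'.baseChange U) (g := g'.baseChange U)
        (Module.Flat.lTensor_preserves_injective_linearMap f' hf')
        (lTensor_exact U hfg' hg') (LinearMap.lTensor_surjective U hg') (reg hC') ?_
      rw [map_smul, map_smul, LinearMap.baseChange_tmul, LinearMap.baseChange_tmul]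
      refine Submodule.smul_induction_on hw (fun j hj v _ => ?_) fun a b ha hb => ?_
      · rw [← smul_tmul, ← Algebra.algebraMap_eq_smul_one, ← mul_one (algebraMap R U j),
          ← smul_eq_mul, ← smul_tmul', smul_smul]
        exact smul_mem _ (by rw [mul_comm]; exact hJ _ (Ideal.mem_map_of_mem _ hj))
      · rw [tmul_add, smul_add]
        exact add_mem ha hb
  have := map_mem_smul_top ((AlgebraTensorModule.rid R U U).toLinearMap ∘ₗ φ.baseChange U) key
  simpa [hφ] using this

theorem exact_dualMap {R F N : Type*} [CommRing R] [AddCommGroup F] [Module R F]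
    [AddCommGroup N] [Module R N] {p : F →ₗ[R] N} (hp : Function.Surjective p) :
    Function.Exact p.dualMap (LinearMap.ker p).subtype.dualMap := by
  rw [LinearMap.exact_iff, LinearMap.range_dualMap_eq_dualAnnihilator_ker_of_surjective p hp]
  exact (Submodule.dualRestrict_ker_eq_dualAnnihilator _)

theorem dualMap_subtype_ker_surjective {R : Type u} [CommRing R] {F N : Type u} [AddCommGroup F]
    [Module R F] [AddCommGroup N] [Module R N] {p : F →ₗ[R] N} (hp : Function.Surjective p)
    (h : Subsingleton (Abelian.Ext (ModuleCat.of R N) (ModuleCat.of R R) 1)) :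
    Function.Surjective (LinearMap.ker p).subtype.dualMap :=
  fun φ => exists_extend_of_subsingleton_ext hp h φ

theorem isSyz_dual {R : Type u} [CommRing R] {n : ℕ} {N : ModuleCat.{u} R} (hN : IsFP R n N)
    (h : ∀ i > 0, Subsingleton (Abelian.Ext N (ModuleCat.of R R) i)) :
    IsSyz (fun G => Module.Flat R G) n (ModuleCat.of R (Module.Dual R N)) := by
  induction n generalizing N with
  | zero => trivial
  | succ n ih =>
    obtain ⟨k, p, hp, hK⟩ := hN
    refine ⟨ModuleCat.of R (Module.Dual R (Fin k → R)),
      ModuleCat.of R (Module.Dual R (LinearMap.ker p)), p.dualMap,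
      (LinearMap.ker p).subtype.dualMap,
      inferInstanceAs (Module.Flat R (Module.Dual R (Fin k → R))),
      LinearMap.dualMap_injective_of_surjective hp, exact_dualMap hp,
      dualMap_subtype_ker_surjective hp (h 1 one_pos),
      ih hK fun i hi => subsingleton_ext_ker_s16 hp hi (h _ (by omega))⟩

theorem isWeaklyRegular_cancelBaseChange {R S U M : Type u} [CommRing R] [CommRing S] [CommRing U]
    [Algebra R S] [Algebra R U] [Algebra S U] [IsScalarTower R S U] [Module.Flat S U]
    [AddCommGroup M] [Module R M] {rs : List S} (hr : IsWeaklyRegular (S ⊗[R] M) rs) :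
    IsWeaklyRegular (U ⊗[R] M) (rs.map (algebraMap S U)) :=
  ((AlgebraTensorModule.cancelBaseChange R S U U M).isWeaklyRegular_congr _).1
    (hr.of_flat_of_isBaseChange (TensorProduct.isBaseChange S (S ⊗[R] M) U))

theorem exists_surjective_residueField {R M : Type*} [CommRing R] [IsLocalRing R] [AddCommGroup M]
    [Module R M] [Module.Finite R M] [Nontrivial M] :
    ∃ q : M →ₗ[R] IsLocalRing.ResidueField R, Function.Surjective q := by
  obtain ⟨P, hP⟩ := IsCoatomic.exists_coatom (Submodule R M)
  have := isSimpleModule_iff_isCoatom.mpr hP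
  obtain ⟨I, hI, ⟨e⟩⟩ := isSimpleModule_iff_quot_maximal.mp this
  rw [IsLocalRing.eq_maximalIdeal hI] at e
  exact ⟨e.toLinearMap ∘ₗ P.mkQ, e.surjective.comp P.mkQ_surjective⟩

theorem isRegular_of_isWeaklyRegular {R S M : Type*} [CommRing R] [IsLocalRing R] [CommRing S]
    [Algebra R S] [Module.FaithfullyFlat R S] [AddCommGroup M] [Module R M] [Module.Finite R M]
    [Nontrivial M] {rs : List S}
    (hrs : ∀ r ∈ rs, r ∈ (IsLocalRing.maximalIdeal R).map (algebraMap R S))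
    (h : IsWeaklyRegular (S ⊗[R] M) rs) : IsRegular (S ⊗[R] M) rs := by
  refine ⟨h, fun htop => ?_⟩
  obtain ⟨q, hq⟩ := exists_surjective_residueField (R := R) (M := M)
  have hzero : ∀ j ∈ (IsLocalRing.maximalIdeal R).map (algebraMap R S),
      ∀ y : S ⊗[R] IsLocalRing.ResidueField R, j • y = 0 := by
    intro j hj y
    have hle : (IsLocalRing.maximalIdeal R).map (algebraMap R S) ≤
        Module.annihilator S (S ⊗[R] IsLocalRing.ResidueField R) := by
      rw [Ideal.map_le_iff_le_comap]
      intro j hj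
      rw [Ideal.mem_comap, Module.mem_annihilator]
      intro y
      rw [algebraMap_smul]
      induction y with
      | zero => rw [smul_zero]
      | add a b ha hb => rw [smul_add, ha, hb, add_zero]
      | tmul s k =>
        rw [← tmul_smul, Algebra.smul_def, IsLocalRing.ResidueField.algebraMap_eq,
          (IsLocalRing.residue_eq_zero_iff j).2 hj, zero_mul, tmul_zero]
    exact Module.mem_annihilator.1 (hle hj) y
  have hall (x : S ⊗[R] M) : q.baseChange S x = 0 := by
    have hx : x ∈ Ideal.ofList rs • (⊤ : Submodule S (S ⊗[R] M)) := htop ▸ trivial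
    refine Submodule.smul_induction_on hx (fun j hj v _ => ?_) fun a b ha hb => ?_
    · rw [map_smul]
      exact hzero j (Ideal.span_le.2 hrs hj) _
    · rw [map_add, ha, hb, add_zero]
  obtain ⟨y, hy⟩ := exists_ne (0 : S ⊗[R] IsLocalRing.ResidueField R)
  obtain ⟨x, rfl⟩ := LinearMap.lTensor_surjective S hq y
  exact hy (hall x)

theorem exists_fg_le_mem_smul_top {R N : Type*} [CommRing R] [AddCommGroup N] [Module R N]
    {I : Ideal R} {x : N} (hx : x ∈ I • (⊤ : Submodule R N)) :
    ∃ J ≤ I, J.FG ∧ x ∈ J • (⊤ : Submodule R N) := by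
  refine Submodule.smul_induction_on hx (fun r hr n _ => ?_) ?_
  · exact ⟨Ideal.span {r}, by simpa [Ideal.span_le] using hr, Submodule.fg_span_singleton r,
      Submodule.smul_mem_smul (Ideal.mem_span_singleton_self r) trivial⟩
  · rintro a b ⟨J, hJ, hJf, ha⟩ ⟨K, hK, hKf, hb⟩
    exact ⟨J ⊔ K, sup_le hJ hK, Submodule.FG.sup hJf hKf,
      add_mem (Submodule.smul_mono_left le_sup_left ha) (Submodule.smul_mono_left le_sup_right hb)⟩

theorem exists_fg_le_forall_mem_map {R S : Type*} [CommRing R] [CommRing S] [Algebra R S]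
    {I : Ideal R} {rs : List S} (hrs : ∀ r ∈ rs, r ∈ I.map (algebraMap R S)) :
    ∃ J ≤ I, J.FG ∧ ∀ r ∈ rs, r ∈ J.map (algebraMap R S) := by
  induction rs with
  | nil => exact ⟨⊥, bot_le, Submodule.fg_bot, by simp⟩
  | cons a rs ih =>
    obtain ⟨J, hJ, hJf, h⟩ := ih fun r hr => hrs r (by simp [hr])
    have ha : a ∈ I • (⊤ : Submodule R S) := by
      rw [Ideal.smul_top_eq_map]; exact hrs a (by simp)
    obtain ⟨K, hK, hKf, h'⟩ := exists_fg_le_mem_smul_top ha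
    rw [Ideal.smul_top_eq_map] at h'
    refine ⟨J ⊔ K, sup_le hJ hK, Submodule.FG.sup hJf hKf, fun r hr => ?_⟩
    obtain rfl | hr := List.mem_cons.1 hr
    · exact Ideal.map_mono le_sup_right h'
    · exact Ideal.map_mono le_sup_left (h r hr)

theorem exists_polynomial_span_coeff {R : Type*} [CommRing R] {J : Ideal R} (hJ : J.FG) :
    ∃ P : R[X], Ideal.span (Set.range P.coeff) = J := by
  classical
  obtain ⟨k, a, rfl⟩ := Submodule.fg_iff_exists_fin_generating_family.1 hJ
  refine ⟨ofFn k a, le_antisymm (Ideal.span_le.2 ?_) (Ideal.span_le.2 ?_)⟩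
  · rintro _ ⟨i, rfl⟩
    by_cases hi : i < k
    · rw [ofFn_coeff_eq_val_of_lt a hi]
      exact Ideal.subset_span ⟨_, rfl⟩
    · rw [ofFn_coeff_eq_zero_of_ge a (by omega)]
      exact zero_mem _
  · rintro _ ⟨i, rfl⟩
    refine Ideal.subset_span ⟨i, ?_⟩
    rw [ofFn_coeff_eq_val_of_lt a i.2]

/-- Adjoining a variable produces a regular element out of an ideal without annihilators. -/
theorem isWeaklyRegular_polynomial {T : Type*} [CommRing T] {xs : List T}
    (hx : IsWeaklyRegular T xs) {P : T[X]}
    (hP : ∀ z : T, (∀ i, z * P.coeff i ∈ Ideal.ofList xs) → z ∈ Ideal.ofList xs) :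
    IsWeaklyRegular T[X] (xs.map C ++ [P]) := by
  refine (isWeaklyRegular_append_iff _ _ _).2
    ⟨hx.of_flat (S := T[X]), (isWeaklyRegular_singleton_iff _ _).2 ?_⟩
  rw [isSMulRegular_quotient_iff_mem_of_smul_mem]
  intro Q hQ
  rw [smul_eq_mul, Ideal.mul_top, ← Ideal.map_ofList] at hQ ⊢
  set I := Ideal.ofList xs
  have hQ' (Q : T[X]) : Q ∈ I.map C ↔ Q.map (Ideal.Quotient.mk I) = 0 := by
    rw [Ideal.mem_map_C_iff, Polynomial.ext_iff]
    simp [Ideal.Quotient.eq_zero_iff_mem]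
  rw [hQ', smul_eq_mul, Polynomial.map_mul] at hQ
  rw [hQ']
  refine (mul_left_mem_nonZeroDivisors_eq_zero_iff
    (Polynomial.mem_nonZeroDivisors_iff.2 fun a ha => ?_)).1 hQ
  obtain ⟨z, rfl⟩ := Ideal.Quotient.mk_surjective a
  refine Ideal.Quotient.eq_zero_iff_mem.2 (hP z fun i => ?_)
  rw [← Ideal.Quotient.eq_zero_iff_mem, map_mul]
  simpa using congrArg (fun Q => Q.coeff i) ha

instance FFExt.instFaithfullyFlat {R : Type u} [CommRing R] (E : FFExt R) :
    Module.FaithfullyFlat R E.S := E.faithfullyFlat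

attribute [local instance] Algebra.TensorProduct.rightAlgebra in
theorem flat_tensorProduct_right (R S T : Type*) [CommRing R] [CommRing S] [CommRing T]
    [Algebra R S] [Algebra R T] [Module.Flat R T] : Module.Flat S (T ⊗[R] S) :=
  Module.Flat.of_linearEquiv
    (Algebra.TensorProduct.commRight R S T).symm.toLinearEquiv

section Coresolution

variable {R : Type u} [CommRing R] {M G C G' C' : ModuleCat.{u} R} {f : M →ₗ[R] G} {g : G →ₗ[R] C}
  {f' : C →ₗ[R] G'} {g' : G' →ₗ[R] C'} [Module.Flat R G] [Module.Flat R G'] {n : ℕ}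
  {J : Ideal R} {w : G} {φ : G →ₗ[R] R}

attribute [local instance] Algebra.TensorProduct.rightAlgebra in
theorem mem_ofList_of_mul_mem_of_faithfullyFlat {S T : Type u} [CommRing S] [CommRing T]
    [Algebra R S] [Algebra R T] [Module.FaithfullyFlat R S] [Module.Flat R T]
    (hf : Function.Injective f) (hfg : Function.Exact f g) (hg : Function.Surjective g)
    (hf' : Function.Injective f') (hfg' : Function.Exact f' g') (hg' : Function.Surjective g')
    (hC' : IsSyz (fun G => Module.Flat R G) n C')
    (hφ : φ w = 1) (hw : f' (g w) ∈ J • (⊤ : Submodule R G'))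
    {rs : List S} {xs : List T} (hn : rs.length ≤ n) (hlen : xs.length < rs.length)
    (hrs : ∀ r ∈ rs, r ∈ J.map (algebraMap R S)) (hr : IsWeaklyRegular (S ⊗[R] M) rs)
    (hx : IsWeaklyRegular T xs) {z : T} (hz : ∀ j ∈ J, j • z ∈ Ideal.ofList xs) :
    z ∈ Ideal.ofList xs := by
  have := flat_tensorProduct_right R S T
  have : Module.Flat R (T ⊗[R] S) := Module.Flat.trans R T (T ⊗[R] S)
  rw [← Ideal.comap_map_eq_self_of_faithfullyFlat (B := T ⊗[R] S) (Ideal.ofList xs),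
    Ideal.mem_comap, Ideal.map_ofList]
  refine mem_ofList_of_mul_mem (rs := rs.map (algebraMap S (T ⊗[R] S))) hf hfg hg hf' hfg' hg' hC'
    hφ hw (by simpa using hn) (by simpa using hlen) ?_
    (isWeaklyRegular_cancelBaseChange hr) hx.of_flat fun j hj => ?_
  · simp only [List.mem_map, forall_exists_index, and_imp, forall_apply_eq_imp_iff₂]
    intro r hr
    have := Ideal.mem_map_of_mem (algebraMap S (T ⊗[R] S)) (hrs r hr)
    rwa [Ideal.map_map, ← IsScalarTower.algebraMap_eq] at this
  · rw [← algebraMap_smul T j, Algebra.smul_def, ← map_mul, ← Ideal.map_ofList, ← Algebra.smul_def]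
    exact Ideal.mem_map_of_mem _ (hz j hj)

theorem exists_isWeaklyRegular_of_coresolution
    (hf : Function.Injective f) (hfg : Function.Exact f g) (hg : Function.Surjective g)
    (hf' : Function.Injective f') (hfg' : Function.Exact f' g') (hg' : Function.Surjective g')
    (hC' : IsSyz (fun G => Module.Flat R G) n C') (hJ : J.FG)
    (hφ : φ w = 1) (hw : f' (g w) ∈ J • (⊤ : Submodule R G'))
    (E : FFExt R) {rs : List E.S} (hn : rs.length ≤ n)
    (hrs : ∀ r ∈ rs, r ∈ J.map (algebraMap R E.S)) (hr : IsWeaklyRegular (E.S ⊗[R] M) rs)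
    {k : ℕ} (hk : k ≤ rs.length) :
    ∃ (T : FFExt R) (xs : List T.S), xs.length = k ∧
      (∀ x ∈ xs, x ∈ J.map (algebraMap R T.S)) ∧ IsWeaklyRegular T.S xs := by
  induction k with
  | zero => exact ⟨⟨R, inferInstance⟩, [], rfl, by simp, IsWeaklyRegular.nil _ _⟩
  | succ k ih =>
    obtain ⟨T, xs, rfl, hxJ, hx⟩ := ih (by omega)
    obtain ⟨P, rfl⟩ := exists_polynomial_span_coeff hJ
    have : Module.FaithfullyFlat T.S T.S[X] :=
      Module.FaithfullyFlat.of_linearEquiv _ _ (Polynomial.basisMonomials T.S).repr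
    have hff : Module.FaithfullyFlat R T.S[X] := Module.FaithfullyFlat.trans R T.S T.S[X]
    refine ⟨⟨T.S[X], hff⟩, xs.map Polynomial.C ++ [P.map (algebraMap R T.S)], by simp, ?_,
      isWeaklyRegular_polynomial hx fun z hz => ?_⟩
    · intro x hxm
      rw [IsScalarTower.algebraMap_eq R T.S T.S[X], ← Ideal.map_map]
      rcases List.mem_append.1 hxm with hxm | hxm
      · obtain ⟨y, hy, rfl⟩ := List.mem_map.1 hxm
        exact Ideal.mem_map_of_mem _ (hxJ y hy)
      · obtain rfl := List.mem_singleton.1 hxm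
        refine Ideal.mem_map_C_iff.2 fun i => ?_
        rw [coeff_map]
        exact Ideal.mem_map_of_mem _ (Ideal.subset_span ⟨i, rfl⟩)
    · refine mem_ofList_of_mul_mem_of_faithfullyFlat hf hfg hg hf' hfg' hg' hC' hφ hw hn
        (by omega) hrs hr hx fun j hj => ?_
      induction hj using Submodule.span_induction with
      | mem j hj =>
        obtain ⟨i, rfl⟩ := hj
        simpa [Algebra.smul_def, mul_comm] using hz i
      | zero => simp
      | add a b _ _ ha hb => simpa [add_smul] using add_mem ha hb
      | smul a b _ hb =>
        rw [smul_assoc, ← algebraMap_smul T.S a]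
        exact Ideal.mul_mem_left _ _ hb

end Coresolution

theorem dual_mem_smul_top {R : Type*} [CommRing R] {k : ℕ} {I : Ideal R}
    {ψ : Module.Dual R (Fin k → R)} (h : ∀ x, ψ x ∈ I) :
    ψ ∈ I • (⊤ : Submodule R (Module.Dual R (Fin k → R))) := by
  have : ψ = ∑ i, ψ (Pi.single i 1) • LinearMap.proj i := by
    ext i
    simp [Pi.single_apply]
  rw [this]
  exact sum_mem fun i _ => Submodule.smul_mem_smul (h _) trivial

theorem exists_isRegular_of_memGtilde {R : Type u} [CommRing R] [IsLocalRing R] {M : Type u}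
    [AddCommGroup M] [Module R M] [Nontrivial M] (hG : MemGtilde R (ModuleCat.of R M))
    (E : FFExt R) {rs : List E.S}
    (hrs : ∀ r ∈ rs, r ∈ (IsLocalRing.maximalIdeal R).map (algebraMap R E.S))
    (hr : IsWeaklyRegular (E.S ⊗[R] M) rs) :
    ∃ (T : FFExt R) (xs : List T.S), xs.length = rs.length ∧
      (∀ x ∈ xs, x ∈ (IsLocalRing.maximalIdeal R).map (algebraMap R T.S)) ∧
      IsWeaklyRegular T.S xs := by
  obtain ⟨⟨_, hrefl, _, hext⟩, _, hfp⟩ := hG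
  have : Module.IsReflexive R M := hrefl
  have : Module.Finite R (Module.Dual R M) := hfp 0
  have : Nontrivial (Module.Dual R M) := by
    by_contra h
    rw [not_nontrivial_iff_subsingleton] at h
    exact not_subsingleton M (Module.evalEquiv R M).subsingleton
  have hext' (i : ℕ) (hi : 0 < i) := subsingleton_abelianExt_of_extZero hi (hext i hi)
  obtain ⟨k, p, hp, k', p', hp', hfpK'⟩ := hfp (rs.length + 2)
  have hextK (i : ℕ) (hi : 0 < i) := subsingleton_ext_ker_s16 hp hi (hext' (1 + i) (by omega))
  have hextK' (i : ℕ) (hi : 0 < i) := subsingleton_ext_ker_s16 hp' hi (hextK (1 + i) (by omega))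
  obtain ⟨q, hq⟩ := exists_surjective_residueField (R := R) (M := Module.Dual R M)
  obtain ⟨w, hw⟩ := Module.projective_lifting_property
    (Algebra.linearMap R (IsLocalRing.ResidueField R)) (q ∘ₗ p) IsLocalRing.residue_surjective
  obtain ⟨e, he⟩ := (hq.comp hp) 1
  have hw (x) : IsLocalRing.residue R (w x) = q (p x) := LinearMap.congr_fun hw x
  have hu : IsUnit (w e) := by
    rw [← IsLocalRing.residue_ne_zero_iff_isUnit, hw, ← Function.comp_apply (f := q), he]
    exact one_ne_zero
  obtain ⟨u, hu⟩ := hu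
  have hmem : p'.dualMap ((LinearMap.ker p).subtype.dualMap w) ∈ IsLocalRing.maximalIdeal R •
      (⊤ : Submodule R (Module.Dual R (Fin k' → R))) := by
    refine dual_mem_smul_top fun x => ?_
    rw [← IsLocalRing.residue_eq_zero_iff]
    exact (hw _).trans ((congrArg q (p' x).2).trans (map_zero q))
  obtain ⟨J₁, hJ₁, hJ₁f, hmem⟩ := exists_fg_le_mem_smul_top hmem
  obtain ⟨J₂, hJ₂, hJ₂f, hrs⟩ := exists_fg_le_forall_mem_map hrs
  have hJ : J₁ ⊔ J₂ ≤ IsLocalRing.maximalIdeal R := sup_le hJ₁ hJ₂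
  obtain ⟨T, xs, hlen, hxs, hx⟩ := exists_isWeaklyRegular_of_coresolution
    (M := ModuleCat.of R M) (G := ModuleCat.of R (Module.Dual R (Fin k → R)))
    (C := ModuleCat.of R (Module.Dual R (LinearMap.ker p)))
    (G' := ModuleCat.of R (Module.Dual R (Fin k' → R)))
    (C' := ModuleCat.of R (Module.Dual R (LinearMap.ker p')))
    (f := p.dualMap ∘ₗ (Module.evalEquiv R M).toLinearMap) (g := (LinearMap.ker p).subtype.dualMap)
    (f' := p'.dualMap) (g' := (LinearMap.ker p').subtype.dualMap) (w := w)
    (φ := (↑u⁻¹ : R) • Module.Dual.eval R _ e)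
    ((LinearMap.dualMap_injective_of_surjective hp).comp (Module.evalEquiv R M).injective)
    ((Module.evalEquiv R M).surjective.comp_exact_iff_exact.2 (exact_dualMap hp))
    (dualMap_subtype_ker_surjective hp (hext' 1 one_pos))
    (LinearMap.dualMap_injective_of_surjective hp') (exact_dualMap hp')
    (dualMap_subtype_ker_surjective hp' (hextK 1 one_pos))
    (isSyz_dual hfpK' hextK') (Submodule.FG.sup hJ₁f hJ₂f) (by simp [← hu])
    (Submodule.smul_mono_left le_sup_left hmem) E le_rfl
    (fun r hr => Ideal.map_mono le_sup_right (hrs r hr)) hr le_rfl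
  exact ⟨T, xs, hlen, fun x hx => Ideal.map_mono hJ (hxs x hx), hx⟩

theorem isWeaklyRegular_of_memGtilde {R : Type u} [CommRing R] {M : Type u}
    [AddCommGroup M] [Module R M] (hG : MemGtilde R (ModuleCat.of R M))
    {S : Type u} [CommRing S] [Algebra R S] [Module.Flat R S] {rs : List S}
    (hr : IsWeaklyRegular S rs) : IsWeaklyRegular (S ⊗[R] M) rs := by
  obtain ⟨⟨_, hrefl, _, hext⟩, _, hfp⟩ := hG
  have : Module.IsReflexive R M := hrefl
  have h : IsSyz (fun G => Module.Flat R G) rs.length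
      (ModuleCat.of R (Module.Dual R (Module.Dual R M))) :=
    isSyz_dual (hfp _) fun i hi => subsingleton_abelianExt_of_extZero hi (hext i hi)
  exact (((Module.evalEquiv R M).baseChange R S _ _).isWeaklyRegular_congr rs).2
    (h.baseChange hr).isWeaklyRegular

theorem le_depth {R : Type u} [CommRing R] [IsLocalRing R] {M : Type u}
    [AddCommGroup M] [Module R M] [Module.Finite R M] [Nontrivial M] (E : FFExt R) {rs : List E.S}
    (hrs : ∀ r ∈ rs, r ∈ (IsLocalRing.maximalIdeal R).map (algebraMap R E.S))
    (hr : IsWeaklyRegular (E.S ⊗[R] M) rs) : (rs.length : ℕ∞) ≤ depth R M :=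
  le_iSup_of_le E (le_iSup_of_le ⟨rs, hrs, isRegular_of_isWeaklyRegular hrs hr⟩ le_rfl)

end AB

theorem depth_eq_of_memGtilde (R : Type u) [CommRing R] [IsLocalRing R] (M : Type u)
    [AddCommGroup M] [Module R M] (hM0 : Nontrivial M)
    (hG : AB.MemGtilde R (ModuleCat.of R M)) :
    AB.depth R M = AB.depth R R := by
  have : Module.Finite R M := hG.1.1
  refine le_antisymm (iSup_le fun E => iSup_le ?_) (iSup_le fun E => iSup_le ?_)
  · rintro ⟨rs, hrs, hr⟩
    obtain ⟨T, xs, hlen, hxs, hx⟩ := AB.exists_isRegular_of_memGtilde hG E hrs hr.1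
    rw [← hlen]
    exact AB.le_depth T hxs
      (((TensorProduct.AlgebraTensorModule.rid R T.S T.S).isWeaklyRegular_congr xs).2 hx)
  · rintro ⟨rs, hrs, hr⟩
    exact AB.le_depth E hrs (AB.isWeaklyRegular_of_memGtilde hG
      (((TensorProduct.AlgebraTensorModule.rid R E.S E.S).isWeaklyRegular_congr rs).1 hr.1))
end
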